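/- arXiv:1808.03290 — 3 statements merged into one kernel-verified Lean document; each statement's English description precedes it below -/
import Mathlib

section
/- Let q be an odd prime power, δ a generator of 𝔽_{q²}ˣ, and M ⊆ ℤ/(q²−1)ℤ a union of cosets of the subgroup (q−1)ℤ/(q²−1)ℤ. For i, j ∈ ℤ/(q²−1)ℤ with i ≢ j (mod q−1), let x_{i,j} be the unique element with δ^{x_{i,j}} = 1 + δ^{j−i}, let y_{i,j} = x_{i,j} + i − j, l(i,j) = i − x_{i,j}(q−1), and k(i,j) = j − y_{i,j}(q−1). Let Λ_{M,δ} be the group presented by generators d, s and a_i for i ∈ M, with relations d^{q+1} = s² = (sd)² = 1, s·a_i·s = a_{qi}, d·a_i·d⁻¹ = a_{i+1−q}, a_{i+(q²−1)/2}·a_i = 1 for all i ∈ M, and a_i·a_j = a_{k(i,j)}·a_{l(i,j)} for all i, j ∈ M with i ≢ j (mod q−1). Then, with S₀ = {δ^{−i(q+1)} : i ∈ M} ⊆ 𝔽_qˣ, the assignment d ↦ [δ], s ↦ [j], a_i ↦ [1 + δ^i·j] extends to a group isomorphism Λ_{M,δ} ≅ Λ_S. -/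
open Polynomial Quaternion

noncomputable section

/-- The multiplicative set of `𝔽_q[t]` generated by `t` and `t - τ` for `τ ∈ S₀`. -/
def sden (F : Type) [Field F] (S₀ : Set F) : Submonoid F[X] :=
  Submonoid.closure ({X} ∪ (fun τ : F => X - C τ) '' S₀)

/-- The ring `o_S`, the localization of `𝔽_q[t]` inverting `t` and `t - τ` for `τ ∈ S₀`. -/
abbrev OS (F : Type) [Field F] (S₀ : Set F) := Localization (sden F S₀)

/-- The quaternion algebra `ℍ[o_S, c, t]` with `i² = c`, `j² = t`, `ij = -ji = k`. -/
abbrev QAS (F : Type) [Field F] (S₀ : Set F) (c : F) : Type :=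
  ℍ[OS F S₀, algebraMap F[X] (OS F S₀) (C c), algebraMap F[X] (OS F S₀) X]

/-- The central subgroup of scalar units. -/
def scalarUnits (R A : Type*) [CommRing R] [Ring A] [Algebra R A] : Subgroup Aˣ :=
  (Units.map (algebraMap R A).toMonoidHom).range

instance scalarUnits_normal (R A : Type*) [CommRing R] [Ring A] [Algebra R A] :
    (scalarUnits R A).Normal := by
  constructor
  intro n hn g
  obtain ⟨r, rfl⟩ := hn
  refine ⟨r, ?_⟩
  ext
  simp only [Units.val_mul, Units.coe_map, RingHom.toMonoidHom_eq_coe, MonoidHom.coe_coe]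
  rw [← Algebra.commutes (r : R) ((g : Aˣ) : A), mul_assoc, Units.mul_inv, mul_one]

/-- The group `Λ_S = ℍ[o_S, c, t]ˣ/o_Sˣ`. -/
abbrev LambdaS (F : Type) [Field F] (S₀ : Set F) (c : F) : Type :=
  (QAS F S₀ c)ˣ ⧸ scalarUnits (OS F S₀) (QAS F S₀ c)

/-- The class `[w]` of a unit `w`. -/
abbrev clsS (F : Type) [Field F] (S₀ : Set F) (c : F) : (QAS F S₀ c)ˣ →* LambdaS F S₀ c :=
  QuotientGroup.mk' _

/-- The canonical map `F → o_S`. -/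
def toOS (F : Type) [Field F] (S₀ : Set F) : F →+* OS F S₀ :=
  (algebraMap F[X] (OS F S₀)).comp (C : F →+* F[X])

/-- The quaternion `1 + α·j = 1 + x·j + y·k` for `α = x + y·√c ∈ 𝔽_{q²}`. -/
def oneAddJ (F : Type) [Field F] (S₀ : Set F) (c : F) (x y : F) : QAS F S₀ c :=
  ⟨1, 0, toOS F S₀ x, toOS F S₀ y⟩

/-- `α = x + y·√c` in `𝔽_{q²} = F(√c)`. -/
def hasCoord (F : Type) [Field F] (E : Type) [Field E] [Algebra F E] (s : E)
    (α : E) (x y : F) : Prop :=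
  α = algebraMap F E x + algebraMap F E y * s

/-- The set `PA_τ = {[1 + α·j] : α ∈ 𝔽_{q²}, N(α) = α^{q+1} = τ⁻¹} ⊆ Λ_S`. -/
def PASet (F : Type) [Field F] [Fintype F] (E : Type) [Field E] [Algebra F E] (s : E)
    (S₀ : Set F) (c : F) (τ : F) : Set (LambdaS F S₀ c) :=
  {z | ∃ (α : E) (x y : F) (w : (QAS F S₀ c)ˣ),
    hasCoord F E s α x y ∧
    α ^ (Fintype.card F + 1) = algebraMap F E τ⁻¹ ∧
    (w : QAS F S₀ c) = oneAddJ F S₀ c x y ∧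
    z = clsS F S₀ c w}

/-- The group `Γ_S`, generated by all `PA_τ`, `τ ∈ S₀`. -/
def GammaS (F : Type) [Field F] [Fintype F] (E : Type) [Field E] [Algebra F E] (s : E)
    (S₀ : Set F) (c : F) : Subgroup (LambdaS F S₀ c) :=
  Subgroup.closure (⋃ τ ∈ S₀, PASet F E s S₀ c τ)


/-- The quaternion `u + v·i` for `u + v·√c ∈ 𝔽_{q²}`. -/
def scalarQ (F : Type) [Field F] (S₀ : Set F) (c : F) (u v : F) : QAS F S₀ c :=
  ⟨toOS F S₀ u, toOS F S₀ v, 0, 0⟩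

/-- The quaternion `j`. -/
def jquat (F : Type) [Field F] (S₀ : Set F) (c : F) : QAS F S₀ c :=
  ⟨0, 0, 1, 0⟩

/-- The set `S₀ = {δ^{-i(q+1)} : i ∈ M} ⊆ 𝔽_qˣ` (viewed inside `𝔽_{q²}`). -/
def SofM (F : Type) [Field F] [Fintype F] (E : Type) [Field E] [Algebra F E]
    (δ : E) (n : ℕ) (M : Set (ZMod n)) : Set F :=
  {τ : F | ∃ i : {x : ZMod n // x ∈ M},
    algebraMap F E τ = ((δ ^ (Fintype.card F + 1))⁻¹) ^ (i : ZMod n).val}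

/-- Generators `d`, `s` and `a_i` for `i ∈ M`. -/
inductive GenM (n : ℕ) (M : Set (ZMod n)) : Type
  | d : GenM n M
  | s : GenM n M
  | a (i : {x : ZMod n // x ∈ M}) : GenM n M

/-- The relations of `Λ_{M,δ}`: `d^{q+1} = s² = (sd)² = 1`, `s a_i s = a_{qi}`,
`d a_i d⁻¹ = a_{i+1-q}`, `a_{i+(q²-1)/2} a_i = 1`, and
`a_i a_j = a_{k(i,j)} a_{l(i,j)}` for `i ≢ j (mod q-1)`. -/
def relsLM (q n : ℕ) (M : Set (ZMod n)) (kf lf : ZMod n → ZMod n → ZMod n) :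
    Set (FreeGroup (GenM n M)) :=
  {FreeGroup.of (GenM.d) ^ (q + 1), FreeGroup.of (GenM.s) ^ 2,
    (FreeGroup.of (GenM.s) * FreeGroup.of (GenM.d)) ^ 2} ∪
  {r | ∃ i j : {x : ZMod n // x ∈ M}, (j : ZMod n) = (q : ZMod n) * (i : ZMod n) ∧
        r = FreeGroup.of (GenM.s) * FreeGroup.of (GenM.a i) * FreeGroup.of (GenM.s) *
          (FreeGroup.of (GenM.a j))⁻¹} ∪
  {r | ∃ i j : {x : ZMod n // x ∈ M}, (j : ZMod n) = (i : ZMod n) + 1 - (q : ZMod n) ∧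
        r = FreeGroup.of (GenM.d) * FreeGroup.of (GenM.a i) * (FreeGroup.of (GenM.d))⁻¹ *
          (FreeGroup.of (GenM.a j))⁻¹} ∪
  {r | ∃ i j : {x : ZMod n // x ∈ M}, (j : ZMod n) = (i : ZMod n) + ((n / 2 : ℕ) : ZMod n) ∧
        r = FreeGroup.of (GenM.a j) * FreeGroup.of (GenM.a i)} ∪
  {r | ∃ i j k l : {x : ZMod n // x ∈ M},
        (i : ZMod n) - (j : ZMod n) ∉ AddSubgroup.zmultiples ((q : ZMod n) - 1) ∧
        (k : ZMod n) = kf i j ∧ (l : ZMod n) = lf i j ∧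
        r = FreeGroup.of (GenM.a i) * FreeGroup.of (GenM.a j) *
          (FreeGroup.of (GenM.a k) * FreeGroup.of (GenM.a l))⁻¹}

section Quaternion

variable {R R' : Type*} [CommRing R'] [CommRing R]

/-- The ring homomorphism of quaternion algebras induced by a homomorphism of the base rings. -/
def quatMap (f : R →+* R') {a b : R} {a' b' : R'} (ha : f a = a') (hb : f b = b') :
    ℍ[R, a, b] →+* ℍ[R', a', b'] where
  toFun w := ⟨f w.re, f w.imI, f w.imJ, f w.imK⟩
  map_one' := by ext <;> simp
  map_zero' := by ext <;> simp
  map_add' _ _ := by ext <;> simp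
  map_mul' _ _ := by ext <;> simp [ha, hb]

/-- The reduced norm of `ℍ[R, a, b]`. -/
def redNorm {a b : R} (w : ℍ[R, a, b]) : R :=
  w.re ^ 2 - a * w.imI ^ 2 - b * (w.imJ ^ 2 - a * w.imK ^ 2)

variable {a b : R}

lemma redNorm_mul (w z : ℍ[R, a, b]) : redNorm (w * z) = redNorm w * redNorm z := by
  simp only [redNorm, QuaternionAlgebra.re_mul, QuaternionAlgebra.imI_mul,
    QuaternionAlgebra.imJ_mul, QuaternionAlgebra.imK_mul]
  ring

@[simp]
lemma redNorm_one : redNorm (1 : ℍ[R, a, b]) = 1 := by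
  simp [redNorm]

lemma redNorm_algebraMap (r : R) : redNorm (algebraMap R ℍ[R, a, b] r) = r ^ 2 := by
  simp [redNorm, QuaternionAlgebra.algebraMap_eq]

lemma redNorm_quatMap (f : R →+* R') {a' b' : R'} (ha : f a = a') (hb : f b = b')
    (w : ℍ[R, a, b]) : redNorm (quatMap f ha hb w) = f (redNorm w) := by
  simp [redNorm, quatMap, ha, hb]

lemma isUnit_redNorm {w : ℍ[R, a, b]} (hw : IsUnit w) : IsUnit (redNorm w) := by
  obtain ⟨w, rfl⟩ := hw
  refine IsUnit.of_mul_eq_one (redNorm (↑w⁻¹ : ℍ[R, a, b])) ?_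
  rw [← redNorm_mul, Units.mul_inv, redNorm_one]

lemma star_mul_self_eq (w : ℍ[R, a, b]) :
    star w * w = algebraMap R ℍ[R, a, b] (redNorm w) := by
  rw [QuaternionAlgebra.algebraMap_eq]
  ext <;> simp [redNorm] <;> ring

lemma mul_star_self_eq (w : ℍ[R, a, b]) :
    w * star w = algebraMap R ℍ[R, a, b] (redNorm w) := by
  rw [QuaternionAlgebra.algebraMap_eq]
  ext <;> simp [redNorm] <;> ring

lemma isUnit_of_isUnit_redNorm {w : ℍ[R, a, b]} (hw : IsUnit (redNorm w)) : IsUnit w := by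
  have h : IsUnit (algebraMap R ℍ[R, a, b] (redNorm w)) := hw.map _
  rw [isUnit_iff_exists_and_exists]
  obtain ⟨z, hz⟩ := h
  refine ⟨⟨star w * ↑z⁻¹, ?_⟩, ⟨↑z⁻¹ * star w, ?_⟩⟩
  · rw [← mul_assoc, mul_star_self_eq, ← hz, Units.mul_inv]
  · rw [mul_assoc, star_mul_self_eq, ← hz, Units.inv_mul]

lemma isUnit_of_isUnit_algebraMap {r : R} (h : IsUnit (algebraMap R ℍ[R, a, b] r)) :
    IsUnit r := by
  have h := isUnit_redNorm h
  rw [redNorm_algebraMap] at h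
  exact (isUnit_pow_iff two_ne_zero).1 h

variable {f : R →+* R'} {a' b' : R'} (ha : f a = a') (hb : f b = b')

lemma quatMap_algebraMap (r : R) :
    quatMap f ha hb (algebraMap R _ r) = algebraMap R' _ (f r) := by
  ext <;> simp [quatMap, QuaternionAlgebra.algebraMap_eq]

lemma eq_algebraMap_of_quatMap (hf : Function.Injective f) {w : ℍ[R, a, b]} {r : R'}
    (h : quatMap f ha hb w = algebraMap R' _ r) : w = algebraMap R _ w.re := by
  rw [QuaternionAlgebra.algebraMap_eq] at h ⊢
  have h' := QuaternionAlgebra.ext_iff.1 h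
  ext
  · rfl
  · exact hf (h'.2.1.trans (map_zero f).symm)
  · exact hf (h'.2.2.1.trans (map_zero f).symm)
  · exact hf (h'.2.2.2.trans (map_zero f).symm)

end Quaternion

section Words

/-- If letters satisfying `p` can be exchanged with letters not satisfying `p`, then every word
has a rearrangement of the same length and value in which the letters satisfying `p` come last. -/
lemma exists_sorted_word {I N : Type*} [Monoid N] (f : I → N) (p : I → Prop)
    (hex : ∀ i j, p i → ¬p j → ∃ k l, ¬p k ∧ p l ∧ f i * f j = f k * f l) (L : List I) :
    ∃ L₁ L₂ : List I, (∀ i ∈ L₁, ¬p i) ∧ (∀ i ∈ L₂, p i) ∧ L₁.length + L₂.length = L.length ∧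
      (L.map f).prod = (L₁.map f).prod * (L₂.map f).prod := by
  have move : ∀ (L : List I) (i : I), p i → (∀ j ∈ L, ¬p j) →
      ∃ (L' : List I) (i' : I), p i' ∧ (∀ j ∈ L', ¬p j) ∧ L'.length = L.length ∧
        f i * (L.map f).prod = (L'.map f).prod * f i' := by
    intro L
    induction L with
    | nil => exact fun i hi _ => ⟨[], i, hi, by simp, rfl, by simp⟩
    | cons j L ih =>
      intro i hi hL
      obtain ⟨k, l, hk, hl, hkl⟩ := hex i j hi (hL j (by simp))
      obtain ⟨L', i', hi', hL', hlen, hprod⟩ := ih l hl fun j hj => hL j (by simp [hj])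
      refine ⟨k :: L', i', hi', ?_, by simp [hlen], ?_⟩
      · simpa [hk] using hL'
      · simp only [List.map_cons, List.prod_cons]
        rw [← mul_assoc, hkl, mul_assoc, hprod, mul_assoc]
  induction L with
  | nil => exact ⟨[], [], by simp, by simp, rfl, by simp⟩
  | cons i L ih =>
    obtain ⟨L₁, L₂, h₁, h₂, hlen, hprod⟩ := ih
    by_cases hi : p i
    · obtain ⟨L', i', hi', hL', hlen', hprod'⟩ := move L₁ i hi h₁
      refine ⟨L', i' :: L₂, hL', by simpa [hi'] using h₂, by simp; lia, ?_⟩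
      simp only [List.map_cons, List.prod_cons]
      rw [hprod, ← mul_assoc, hprod', mul_assoc]
    · refine ⟨i :: L₁, L₂, by simpa [hi] using h₁, h₂, by simp; lia, ?_⟩
      simp only [List.map_cons, List.prod_cons]
      rw [hprod, mul_assoc]

end Words

section QuadraticExtension

variable {F E : Type} [Field F] [Field E] [Algebra F E] {s : E} {c : F}

lemma coord_unique (hc : ¬IsSquare c) (hs : s ^ 2 = algebraMap F E c) {x y x' y' : F}
    (h : algebraMap F E x + algebraMap F E y * s = algebraMap F E x' + algebraMap F E y' * s) :
    x = x' ∧ y = y' := by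
  have hy : y = y' := by
    by_contra hne
    have hne' : y - y' ≠ 0 := sub_ne_zero.2 hne
    apply hc
    refine ⟨(x' - x) / (y - y'), ?_⟩
    rw [div_mul_div_comm, eq_div_iff (mul_ne_zero hne' hne')]
    apply (algebraMap F E).injective
    have h' : algebraMap F E (y - y') * s = algebraMap F E (x' - x) := by
      rw [map_sub, map_sub]; linear_combination h
    rw [map_mul, map_mul, map_mul, ← hs, ← h']
    ring
  subst hy
  exact ⟨(algebraMap F E).injective (add_right_cancel h), rfl⟩

lemma coord_eq_zero (hc : ¬IsSquare c) (hs : s ^ 2 = algebraMap F E c) {x y : F}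
    (h : algebraMap F E x + algebraMap F E y * s = 0) : x = 0 ∧ y = 0 :=
  coord_unique (x' := 0) (y' := 0) hc hs (by simpa using h)

lemma sq_sub_ne_zero (hc : ¬IsSquare c) {x y : F} (h : x ^ 2 - c * y ^ 2 = 0) :
    x = 0 ∧ y = 0 := by
  have hy : y = 0 := by
    by_contra hy
    exact hc ⟨x / y, by field_simp; linear_combination -h⟩
  subst hy
  simpa using h

variable [Fintype F]

lemma sqrt_pow_card (hq : Odd (Fintype.card F)) (hc : ¬IsSquare c)
    (hs : s ^ 2 = algebraMap F E c) : s ^ Fintype.card F = -s := by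
  have hF : ringChar F ≠ 2 := by
    intro h
    have := FiniteField.even_card_of_char_two h
    rw [Nat.odd_iff] at hq
    lia
  have hc0 : c ≠ 0 := by rintro rfl; exact hc (IsSquare.zero)
  have hpow : c ^ (Fintype.card F / 2) = -1 :=
    (FiniteField.pow_dichotomy hF hc0).resolve_left fun h =>
      hc ((FiniteField.isSquare_iff hF hc0).2 h)
  obtain ⟨m, hm⟩ := hq
  have hm' : Fintype.card F / 2 = m := by lia
  rw [hm'] at hpow
  rw [hm, pow_succ, pow_mul, hs, ← map_pow, hpow]
  simp

lemma coord_pow_card (hq : Odd (Fintype.card F)) (hc : ¬IsSquare c)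
    (hs : s ^ 2 = algebraMap F E c) (x y : F) :
    (algebraMap F E x + algebraMap F E y * s) ^ Fintype.card F =
      algebraMap F E x - algebraMap F E y * s := by
  obtain ⟨n, hp, hcard⟩ := FiniteField.card F (ringChar F)
  have : Fact (ringChar F).Prime := ⟨hp⟩
  have : CharP E (ringChar F) := charP_of_injective_algebraMap (algebraMap F E).injective _
  rw [hcard, add_pow_char_pow, ← hcard, mul_pow, ← map_pow, ← map_pow, FiniteField.pow_card,
    FiniteField.pow_card, sqrt_pow_card hq hc hs]
  ring

lemma coord_norm (hq : Odd (Fintype.card F)) (hc : ¬IsSquare c)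
    (hs : s ^ 2 = algebraMap F E c) {α : E} {x y : F} (hα : hasCoord F E s α x y) :
    algebraMap F E (x ^ 2 - c * y ^ 2) = α ^ (Fintype.card F + 1) := by
  rw [pow_succ α, hα, coord_pow_card hq hc hs]
  simp only [map_sub, map_mul, map_pow, ← hs]
  ring

lemma natCard_quadratic (hc : ¬IsSquare c) (hs : s ^ 2 = algebraMap F E c)
    (hspan : ∀ α : E, ∃ x y : F, hasCoord F E s α x y) :
    Nat.card E = Fintype.card F ^ 2 := by
  have e : F × F ≃ E := Equiv.ofBijective
    (fun z => algebraMap F E z.1 + algebraMap F E z.2 * s)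
    ⟨fun z z' h => Prod.ext (coord_unique hc hs h).1 (coord_unique hc hs h).2,
      fun α => let ⟨x, y, h⟩ := hspan α; ⟨(x, y), h.symm⟩⟩
  rw [← Nat.card_congr e, Nat.card_eq_fintype_card, Fintype.card_prod, sq]

/-- The component `P` of `P + Q·j`, as an element of `F(√c)`. -/
def fstPart (s : E) {a b : F} (w : ℍ[F, a, b]) : E :=
  algebraMap F E w.re + algebraMap F E w.imI * s

/-- The component `Q` of `P + Q·j`, as an element of `F(√c)`. -/
def sndPart (s : E) {a b : F} (w : ℍ[F, a, b]) : E :=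
  algebraMap F E w.imJ + algebraMap F E w.imK * s

variable {b : F}

lemma fstPart_mul (hq : Odd (Fintype.card F)) (hc : ¬IsSquare c)
    (hs : s ^ 2 = algebraMap F E c) (w z : ℍ[F, c, b]) :
    fstPart s (w * z) = fstPart s w * fstPart s z +
      algebraMap F E b * (sndPart s w * sndPart s z ^ Fintype.card F) := by
  simp only [fstPart, sndPart, coord_pow_card hq hc hs, QuaternionAlgebra.re_mul,
    QuaternionAlgebra.imI_mul, map_add, map_sub, map_mul, map_zero, ← hs]
  ring

lemma sndPart_mul (hq : Odd (Fintype.card F)) (hc : ¬IsSquare c)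
    (hs : s ^ 2 = algebraMap F E c) (w z : ℍ[F, c, b]) :
    sndPart s (w * z) = fstPart s w * sndPart s z + sndPart s w * fstPart s z ^ Fintype.card F := by
  simp only [fstPart, sndPart, coord_pow_card hq hc hs, QuaternionAlgebra.imJ_mul,
    QuaternionAlgebra.imK_mul, map_add, map_sub, map_mul, map_zero, ← hs]
  ring

/-- A word in the `1 + α·j` with `N(α) = b⁻¹` either can be shortened by a cancellation of
adjacent letters `1 + α·j` and `1 - α·j`, or has a non-zero value. -/
lemma shorten_or_ne_zero (hq : Odd (Fintype.card F)) (hc : ¬IsSquare c)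
    (hs : s ^ 2 = algebraMap F E c) {I G : Type*} [Monoid G] (a : I → G)
    (w : I → ℍ[F, c, b]) (α : I → E) (hfst : ∀ i, fstPart s (w i) = 1)
    (hsnd : ∀ i, sndPart s (w i) = α i) (ha : ∀ i j, α i = -α j → a i * a j = 1) (L : List I)
    (hL : ∀ i ∈ L, algebraMap F E b * α i ^ (Fintype.card F + 1) = 1) :
    (∃ L' : List I, L'.length < L.length ∧ (L'.map a).prod = (L.map a).prod) ∨
      (L.map w).prod ≠ 0 := by
  suffices h : (∃ L' : List I, L'.length < L.length ∧ (L'.map a).prod = (L.map a).prod) ∨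
      (fstPart s (L.map w).prod ≠ 0 ∧ (L = [] ∨ ∃ L₀ i, L = L₀ ++ [i] ∧
        sndPart s (L.map w).prod = fstPart s (L.map w).prod * α i)) by
    refine h.imp_right fun h h0 => h.1 ?_
    rw [h0]
    simp [fstPart]
  induction L using List.reverseRecOn with
  | nil => right; simp [fstPart]
  | append_singleton L i ih =>
    have hi := hL i (by simp)
    rcases ih fun j hj => hL j (by simp [hj]) with ⟨L', hlen, hL'⟩ | ⟨hne, rfl | ⟨L₀, j, rfl, hj⟩⟩
    · exact Or.inl ⟨L' ++ [i], by simpa using hlen, by simp [hL']⟩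
    · exact Or.inr ⟨by simp [hfst], Or.inr ⟨[], i, rfl, by simp [hfst, hsnd]⟩⟩
    · by_cases hji : α j = -α i
      · refine Or.inl ⟨L₀, by simp, ?_⟩
        simp [ha j i hji]
      · right
        generalize hW : ((L₀ ++ [j]).map w).prod = W at hne hj
        rw [List.map_append, List.prod_append, hW, List.map_singleton, List.prod_singleton,
          fstPart_mul hq hc hs, sndPart_mul hq hc hs, hfst, hsnd, hj]
        have key : (fstPart s W * 1 + algebraMap F E b *
            (fstPart s W * α j * α i ^ Fintype.card F)) * α i =
            fstPart s W * (α i + α j) := by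
          rw [pow_succ] at hi
          linear_combination fstPart s W * α j * hi
        refine ⟨fun h0 => ?_, Or.inr ⟨_, i, rfl, ?_⟩⟩
        · rw [h0, zero_mul] at key
          rcases mul_eq_zero.1 key.symm with h | h
          · exact hne h
          · exact hji (by linear_combination h)
        · rw [key, one_pow]
          ring

end QuadraticExtension

section PolynomialQuaternions

variable {F : Type} [Field F] {c : F}

/-- Evaluation `ℍ[F[t], c, t] → ℍ[F, c, τ]` at `t = τ`. -/
def quatEval (c τ : F) : ℍ[F[X], C c, X] →+* ℍ[F, c, τ] :=
  quatMap (evalRingHom τ) (by simp) (by simp)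

lemma redNorm_quatEval (τ : F) (w : ℍ[F[X], C c, X]) :
    redNorm (quatEval c τ w) = (redNorm w).eval τ :=
  redNorm_quatMap _ _ _ w

/-- The quaternion `1 + x·j + y·k` over `F[t]`. -/
def letterQ (c x y : F) : ℍ[F[X], C c, X] := ⟨1, 0, C x, C y⟩

/-- The quaternion `x + y·i` over `F[t]`. -/
def constQ (c x y : F) : ℍ[F[X], C c, X] := ⟨C x, C y, 0, 0⟩

/-- The quaternion `j` over `F[t]`. -/
def jQ (c : F) : ℍ[F[X], C c, X] := ⟨0, 0, 1, 0⟩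

@[simp]
lemma redNorm_letterQ (x y : F) :
    redNorm (letterQ c x y) = 1 - X * C (x ^ 2 - c * y ^ 2) := by
  simp [redNorm, letterQ]

@[simp]
lemma redNorm_constQ (x y : F) : redNorm (constQ c x y) = C (x ^ 2 - c * y ^ 2) := by
  simp [redNorm, constQ]

@[simp]
lemma redNorm_jQ : redNorm (jQ c) = -X := by
  simp [redNorm, jQ]

variable {E : Type} [Field E] [Algebra F E] {s : E}

lemma constQ_mul (hc : ¬IsSquare c) (hs : s ^ 2 = algebraMap F E c) {α β : E}
    {x y x' y' x'' y'' : F} (hα : hasCoord F E s α x y) (hβ : hasCoord F E s β x' y')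
    (hαβ : hasCoord F E s (α * β) x'' y'') :
    constQ c x y * constQ c x' y' = constQ c x'' y'' := by
  have h : x * x' + c * y * y' = x'' ∧ x * y' + y * x' = y'' := by
    refine coord_unique hc hs ?_
    rw [hasCoord, hα, hβ] at hαβ
    rw [← hαβ]
    simp only [map_add, map_mul, ← hs]
    ring
  rw [← h.1, ← h.2]
  ext <;> simp [constQ]

lemma constQ_pow (hc : ¬IsSquare c) (hs : s ^ 2 = algebraMap F E c) {δ : E} {u v : F}
    (hδ : hasCoord F E s δ u v) {m : ℕ} {x y : F} (hm : hasCoord F E s (δ ^ m) x y) :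
    constQ c u v ^ m = constQ c x y := by
  have key : ∃ x y : F, hasCoord F E s (δ ^ m) x y ∧ constQ c u v ^ m = constQ c x y := by
    clear hm
    induction m with
    | zero =>
      refine ⟨1, 0, by simp [hasCoord], ?_⟩
      ext <;> simp [constQ]
    | succ m ih =>
      obtain ⟨x, y, hxy, h⟩ := ih
      have h' : hasCoord F E s (δ ^ m * δ) (x * u + c * y * v) (x * v + y * u) := by
        rw [hasCoord, hxy, hδ]
        simp only [map_add, map_mul, ← hs]
        ring
      exact ⟨_, _, by rwa [pow_succ], by rw [pow_succ, h, constQ_mul hc hs hxy hδ h']⟩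
  obtain ⟨x', y', h, h'⟩ := key
  obtain ⟨rfl, rfl⟩ := coord_unique hc hs (hm.symm.trans h)
  exact h'

variable [Fintype F] {I G : Type*} [Group G] {a : I → G} {α : I → E} {x y : I → F}

/-- A word in the `1 + α·j` whose value is divisible by `t - τ` can be shortened. -/
lemma exists_shorter_word (hq : Odd (Fintype.card F)) (hc : ¬IsSquare c)
    (hs : s ^ 2 = algebraMap F E c) (hα : ∀ i, hasCoord F E s (α i) (x i) (y i))
    (ha : ∀ i j, α i = -α j → a i * a j = 1)
    (hex : ∀ i j, x i ^ 2 - c * y i ^ 2 ≠ x j ^ 2 - c * y j ^ 2 → ∃ k l,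
      x k ^ 2 - c * y k ^ 2 = x j ^ 2 - c * y j ^ 2 ∧
      x l ^ 2 - c * y l ^ 2 = x i ^ 2 - c * y i ^ 2 ∧
      a i * a j = a k * a l ∧
      letterQ c (x i) (y i) * letterQ c (x j) (y j) =
        letterQ c (x k) (y k) * letterQ c (x l) (y l))
    (τ : F) (L : List I)
    (hL : quatEval c τ (L.map fun i => letterQ c (x i) (y i)).prod = 0) :
    ∃ L' : List I, L'.length < L.length ∧ (L'.map a).prod = (L.map a).prod := by
  set w : I → ℍ[F[X], C c, X] := fun i => letterQ c (x i) (y i) with hw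
  obtain ⟨L₁, L₂, h₁, h₂, hlen, hprod⟩ := exists_sorted_word (fun i => (a i, w i))
    (fun i => τ * (x i ^ 2 - c * y i ^ 2) = 1) (by
      intro i j hi hj
      obtain ⟨k, l, hk, hl, hA, hW⟩ := hex i j fun h => hj (h ▸ hi)
      exact ⟨k, l, by rwa [hk], by rwa [hl], Prod.ext hA hW⟩) L
  have hA := congrArg (MonoidHom.fst _ _) hprod
  have hW := congrArg (MonoidHom.snd _ _) hprod
  rw [map_mul, map_list_prod, map_list_prod, map_list_prod, List.map_map, List.map_map,
    List.map_map] at hA hW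
  change (L.map a).prod = (L₁.map a).prod * (L₂.map a).prod at hA
  change (L.map w).prod = (L₁.map w).prod * (L₂.map w).prod at hW
  have hunit : IsUnit (quatEval c τ (L₁.map w).prod) := by
    clear hA hW hprod hlen
    induction L₁ with
    | nil => simp
    | cons i L₁ ih =>
      rw [List.map_cons, List.prod_cons, map_mul]
      refine IsUnit.mul (isUnit_of_isUnit_redNorm ?_) (ih fun j hj => h₁ j (by simp [hj]))
      rw [redNorm_quatEval, hw, redNorm_letterQ, isUnit_iff_ne_zero]
      have := h₁ i (by simp)
      intro h
      apply this
      simp only [eval_sub, eval_one, eval_mul, eval_X, eval_C] at h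
      linear_combination -h
  rw [hW, map_mul, hunit.mul_right_eq_zero, map_list_prod, List.map_map] at hL
  rcases shorten_or_ne_zero (b := τ) hq hc hs a (quatEval c τ ∘ w) α
    (by intro i; simp [fstPart, quatEval, quatMap, hw, letterQ])
    (by intro i; simp [sndPart, quatEval, quatMap, hw, letterQ]; exact (hα i).symm) ha L₂
    (by
      intro i hi
      rw [← coord_norm hq hc hs (hα i), ← map_mul, h₂ i hi, map_one]) with ⟨L', h, h'⟩ | h
  · exact ⟨L₁ ++ L', by simp; lia, by simp [hA, h']⟩
  · exact absurd hL h

/-- The normal form argument: a word `a_{i₁}⋯a_{iₘ} d^m s^ε` whose value is a scalar is trivial. -/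
lemma word_eq_one (hq : Odd (Fintype.card F)) (hc : ¬IsSquare c)
    (hs : s ^ 2 = algebraMap F E c) (hα : ∀ i, hasCoord F E s (α i) (x i) (y i))
    (ha : ∀ i j, α i = -α j → a i * a j = 1)
    (hex : ∀ i j, x i ^ 2 - c * y i ^ 2 ≠ x j ^ 2 - c * y j ^ 2 → ∃ k l,
      x k ^ 2 - c * y k ^ 2 = x j ^ 2 - c * y j ^ 2 ∧
      x l ^ 2 - c * y l ^ 2 = x i ^ 2 - c * y i ^ 2 ∧
      a i * a j = a k * a l ∧
      letterQ c (x i) (y i) * letterQ c (x j) (y j) =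
        letterQ c (x k) (y k) * letterQ c (x l) (y l))
    (hα0 : ∀ i, α i ≠ 0) {δ : E} (hδ : δ ≠ 0) {u v : F} (hδc : hasCoord F E s δ u v)
    (hspan : ∀ α : E, ∃ x y : F, hasCoord F E s α x y)
    {d : G} (hd : ∀ (m : ℕ) (z : F), δ ^ m = algebraMap F E z → d ^ m = 1) {σ : G}
    {K : Type*} [Group K] (φ : G →* K)
    (hφ : ∀ (L : List I) (m ε : ℕ), φ ((L.map a).prod * d ^ m * σ ^ ε) = 1 →
      ∃ f : F[X], (L.map fun i => letterQ c (x i) (y i)).prod * constQ c u v ^ m * jQ c ^ ε =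
        algebraMap _ _ f)
    (m ε : ℕ) (hε : ε < 2) (L : List I) (hL : φ ((L.map a).prod * d ^ m * σ ^ ε) = 1) :
    (L.map a).prod * d ^ m * σ ^ ε = 1 := by
  induction hlen : L.length using Nat.strong_induction_on generalizing L with
  | _ len ih =>
  subst hlen
  obtain ⟨f, hf⟩ := hφ L m ε hL
  rcases L with - | ⟨i, L⟩
  · obtain ⟨p, r, hpr⟩ := hspan (δ ^ m)
    rw [List.map_nil, List.prod_nil, one_mul, constQ_pow hc hs hδc hpr,
      QuaternionAlgebra.algebraMap_eq] at hf
    have hε' : ε = 0 ∨ ε = 1 := by lia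
    rcases hε' with rfl | rfl
    · have hr : r = 0 := by simpa [constQ] using congrArg QuaternionAlgebra.imI hf
      rw [hasCoord, hr, map_zero, zero_mul, add_zero] at hpr
      simp [hd m p hpr]
    · have hp : p = 0 := by simpa [constQ, jQ] using congrArg QuaternionAlgebra.imJ hf
      have hr : r = 0 := by simpa [constQ, jQ] using congrArg QuaternionAlgebra.imK hf
      rw [hasCoord, hp, hr] at hpr
      simp [hδ] at hpr
  · set N := x i ^ 2 - c * y i ^ 2 with hN
    have norm_ne : ∀ {β : E} {p r : F}, β ≠ 0 → hasCoord F E s β p r → p ^ 2 - c * r ^ 2 ≠ 0 := by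
      intro β p r hβ hpr h
      obtain ⟨rfl, rfl⟩ := sq_sub_ne_zero hc h
      exact hβ (by simpa [hasCoord] using hpr)
    have hN0 : N ≠ 0 := norm_ne (hα0 i) (hα i)
    have hf0 : f.eval N⁻¹ = 0 := by
      have h := congrArg (fun z => (redNorm z).eval N⁻¹) hf
      simp only [List.map_cons, List.prod_cons, redNorm_mul, redNorm_letterQ, ← hN,
        redNorm_algebraMap, eval_mul, eval_sub, eval_one, eval_X, eval_C, eval_pow,
        inv_mul_cancel₀ hN0, sub_self, zero_mul] at h
      exact pow_eq_zero_iff two_ne_zero |>.1 h.symm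
    have hunit : IsUnit (quatEval c N⁻¹ (constQ c u v ^ m * jQ c ^ ε)) := by
      rw [map_mul, map_pow, map_pow]
      refine IsUnit.mul (IsUnit.pow _ ?_) (IsUnit.pow _ ?_) <;>
        refine isUnit_of_isUnit_redNorm ?_ <;> rw [redNorm_quatEval, isUnit_iff_ne_zero]
      · simpa using norm_ne hδ hδc
      · simpa using hN0
    have hev := congrArg (quatEval c N⁻¹) hf
    rw [mul_assoc, map_mul, quatEval, quatMap_algebraMap, ← quatEval, coe_evalRingHom, hf0,
      map_zero, hunit.mul_left_eq_zero] at hev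
    obtain ⟨L', hlen, hL'⟩ := exists_shorter_word hq hc hs hα ha hex N⁻¹ (i :: L) hev
    rw [← hL'] at hL ⊢
    exact ih _ hlen L' hL rfl

end PolynomialQuaternions

section Surjectivity

variable {F : Type} [Field F] {c : F}

lemma natDegree_sq_sub (hc : ¬IsSquare c) {f g : F[X]} (h : f ≠ 0 ∨ g ≠ 0) :
    ∃ n, (f ^ 2 - C c * g ^ 2).natDegree = 2 * n ∧ f ^ 2 - C c * g ^ 2 ≠ 0 ∧
      f.natDegree ≤ n ∧ g.natDegree ≤ n := by
  refine ⟨max f.natDegree g.natDegree, ?_⟩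
  rw [← and_assoc]
  refine ⟨?_, le_max_left _ _, le_max_right _ _⟩
  set n := max f.natDegree g.natDegree with hn
  have hf : f.natDegree ≤ n := le_max_left _ _
  have hg : g.natDegree ≤ n := le_max_right _ _
  have hcoeff : (f ^ 2 - C c * g ^ 2).coeff (2 * n) = f.coeff n ^ 2 - c * g.coeff n ^ 2 := by
    rw [coeff_sub, coeff_C_mul, coeff_pow_of_natDegree_le hf, coeff_pow_of_natDegree_le hg]
  have hne : (f ^ 2 - C c * g ^ 2).coeff (2 * n) ≠ 0 := by
    rw [hcoeff]
    intro h0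
    obtain ⟨hf0, hg0⟩ := sq_sub_ne_zero hc h0
    rcases le_total f.natDegree g.natDegree with hle | hle
    · rw [hn, max_eq_right hle, coeff_natDegree, leadingCoeff_eq_zero] at hg0
      subst hg0
      rw [hn, natDegree_zero, max_eq_left (Nat.zero_le _), coeff_natDegree,
        leadingCoeff_eq_zero] at hf0
      simp [hf0] at h
    · rw [hn, max_eq_left hle, coeff_natDegree, leadingCoeff_eq_zero] at hf0
      subst hf0
      rw [hn, natDegree_zero, max_eq_right (Nat.zero_le _), coeff_natDegree,
        leadingCoeff_eq_zero] at hg0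
      simp [hg0] at h
  refine ⟨natDegree_eq_of_le_of_coeff_ne_zero ?_ hne, fun h0 => hne (by rw [h0, coeff_zero])⟩
  refine (natDegree_sub_le _ _).trans (max_le ?_ ((natDegree_C_mul_le _ _).trans ?_)) <;>
    exact natDegree_pow_le_of_le 2 (by assumption)

/-- A quaternion over `F[t]` with constant non-zero reduced norm is constant. -/
lemma eq_constQ_of_redNorm (hc : ¬IsSquare c) {w : ℍ[F[X], C c, X]} {r : F}
    (hr : r ≠ 0) (hw : redNorm w = C r) : ∃ x y, w = constQ c x y := by
  have hJK : w.imJ = 0 ∧ w.imK = 0 := by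
    by_contra hne
    rw [not_and_or] at hne
    obtain ⟨n, hn, hne0, -⟩ := natDegree_sq_sub hc hne
    have heq : w.re ^ 2 - C c * w.imI ^ 2 = C r + X * (w.imJ ^ 2 - C c * w.imK ^ 2) := by
      rw [← hw, redNorm]; ring
    have hdeg := congrArg natDegree heq
    rw [natDegree_C_add, natDegree_X_mul hne0, hn] at hdeg
    by_cases h : w.re ≠ 0 ∨ w.imI ≠ 0
    · obtain ⟨m, hm, -, -⟩ := natDegree_sq_sub hc h
      lia
    · push Not at h
      simp [h.1, h.2] at hdeg
  rw [redNorm, hJK.1, hJK.2] at hw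
  by_cases h : w.re ≠ 0 ∨ w.imI ≠ 0
  · obtain ⟨m, hm, -, hre, him⟩ := natDegree_sq_sub hc h
    have hm0 : m = 0 := by
      have h' : w.re ^ 2 - C c * w.imI ^ 2 = C r := by simpa using hw
      rw [h', natDegree_C] at hm
      lia
    subst hm0
    refine ⟨w.re.coeff 0, w.imI.coeff 0, ?_⟩
    ext1
    · exact eq_C_of_natDegree_le_zero hre
    · exact eq_C_of_natDegree_le_zero him
    · exact hJK.1
    · exact hJK.2
  · push Not at h
    exact absurd (by simpa [h.1, h.2] using hw.symm) hr

lemma exists_of_quatEval_eq_zero {τ : F} {w : ℍ[F[X], C c, X]} (hw : quatEval c τ w = 0) :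
    ∃ w', w = algebraMap F[X] _ (X - C τ) * w' := by
  have h := QuaternionAlgebra.ext_iff.1 hw
  obtain ⟨p₁, h₁⟩ := dvd_iff_isRoot.2 (show IsRoot w.re τ from h.1)
  obtain ⟨p₂, h₂⟩ := dvd_iff_isRoot.2 (show IsRoot w.imI τ from h.2.1)
  obtain ⟨p₃, h₃⟩ := dvd_iff_isRoot.2 (show IsRoot w.imJ τ from h.2.2.1)
  obtain ⟨p₄, h₄⟩ := dvd_iff_isRoot.2 (show IsRoot w.imK τ from h.2.2.2)
  refine ⟨⟨p₁, p₂, p₃, p₄⟩, ?_⟩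
  rw [← Algebra.smul_def]
  ext1 <;> simp [h₁, h₂, h₃, h₄]

lemma quatEval_mul_jQ_eq_zero (hc : ¬IsSquare c) {w : ℍ[F[X], C c, X]}
    (hw : (redNorm w).eval 0 = 0) : quatEval c 0 (w * jQ c) = 0 := by
  obtain ⟨h₁, h₂⟩ := sq_sub_ne_zero hc (x := w.re.eval 0) (y := w.imI.eval 0) (by
    simpa [redNorm] using hw)
  ext <;> simp [quatEval, quatMap, jQ, h₁, h₂]

/-- If the reduced norm of `w` vanishes at `t = τ`, then `w` or some `w·(1 + α·j)` with
`N(α) = τ⁻¹` vanishes at `t = τ`. -/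
lemma quatEval_eq_zero_or (hc : ¬IsSquare c) {τ : F} (hτ : τ ≠ 0) {w : ℍ[F[X], C c, X]}
    (hw : (redNorm w).eval τ = 0) : quatEval c τ w = 0 ∨
      ∃ x y, τ * (x ^ 2 - c * y ^ 2) = 1 ∧ quatEval c τ (w * letterQ c x y) = 0 := by
  rw [← redNorm_quatEval] at hw
  simp only [map_mul]
  generalize quatEval c τ w = z at hw
  obtain ⟨e, f, g, h⟩ := z
  simp only [redNorm] at hw
  by_cases hN : e ^ 2 - c * f ^ 2 = 0
  · left
    obtain ⟨rfl, rfl⟩ := sq_sub_ne_zero hc hN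
    obtain ⟨rfl, rfl⟩ := sq_sub_ne_zero hc (x := g) (y := h) (by simpa [hτ] using hw)
    rfl
  · right
    obtain ⟨x, hx⟩ : ∃ x, x * (e ^ 2 - c * f ^ 2) = -(g * e - c * h * f) :=
      ⟨_, div_mul_cancel₀ _ hN⟩
    obtain ⟨y, hy⟩ : ∃ y, y * (e ^ 2 - c * f ^ 2) = -(h * e - g * f) :=
      ⟨_, div_mul_cancel₀ _ hN⟩
    refine ⟨x, y, ?_, ?_⟩
    · apply mul_right_cancel₀ (pow_ne_zero 2 hN)
      linear_combination τ * (x * (e ^ 2 - c * f ^ 2) - (g * e - c * h * f)) * hx -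
        τ * c * (y * (e ^ 2 - c * f ^ 2) - (h * e - g * f)) * hy - (e ^ 2 - c * f ^ 2) * hw
    · ext <;> simp [quatEval, quatMap, letterQ] <;> apply mul_right_cancel₀ hN
      · linear_combination e * hw + τ * g * hx - c * τ * h * hy
      · linear_combination f * hw - τ * g * hy + τ * h * hx
      · linear_combination e * hx + c * f * hy
      · linear_combination e * hy + f * hx

variable {S₀ : Set F}

lemma sden_le_nonZeroDivisors : sden F S₀ ≤ nonZeroDivisors F[X] := by
  rw [sden, Submonoid.closure_le]
  rintro _ (rfl | ⟨τ, -, rfl⟩)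
  · exact mem_nonZeroDivisors_of_ne_zero X_ne_zero
  · exact mem_nonZeroDivisors_of_ne_zero (X_sub_C_ne_zero τ)

lemma algebraMap_OS_injective : Function.Injective (algebraMap F[X] (OS F S₀)) :=
  IsLocalization.injective (M := sden F S₀) _ sden_le_nonZeroDivisors

instance nontrivial_OS : Nontrivial (OS F S₀) :=
  (algebraMap_OS_injective (S₀ := S₀)).nontrivial

lemma isUnit_algebraMap_X_sub_C {τ : F} (hτ : τ = 0 ∨ τ ∈ S₀) :
    IsUnit (algebraMap F[X] (OS F S₀) (X - C τ)) := by
  refine IsLocalization.map_units (OS F S₀) (⟨X - C τ, ?_⟩ : sden F S₀)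
  apply Submonoid.subset_closure
  rcases hτ with rfl | hτ
  · left; simp
  · right; exact ⟨τ, hτ, rfl⟩

/-- A divisor of a denominator of `o_S` which does not vanish at `0` or in `S₀` is a unit. -/
lemma isUnit_of_isUnit_algebraMap_OS {p : F[X]} (hp : IsUnit (algebraMap F[X] (OS F S₀) p))
    (hroot : ∀ τ, τ = 0 ∨ τ ∈ S₀ → p.eval τ ≠ 0) : IsUnit p := by
  obtain ⟨m, hm, hpm⟩ := (IsLocalization.algebraMap_isUnit_iff (sden F S₀)).1 hp
  have hlin : ∀ τ, τ = 0 ∨ τ ∈ S₀ → IsCoprime p (X - C τ) := fun τ hτ =>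
    ((irreducible_X_sub_C τ).coprime_iff_not_dvd.2 fun h =>
      hroot τ hτ (dvd_iff_isRoot.1 h)).symm
  have hcop : IsCoprime p m := by
    clear hpm
    induction hm using Submonoid.closure_induction with
    | mem x hx =>
      rcases hx with rfl | ⟨τ, hτ, rfl⟩
      · simpa using hlin 0 (Or.inl rfl)
      · exact hlin τ (Or.inr hτ)
    | one => exact isCoprime_one_right
    | mul x y _ _ hx hy => exact hx.mul_right hy
  exact hcop.isUnit_of_dvd' dvd_rfl hpm

/-- The map `ℍ[F[t], c, t] → ℍ[o_S, c, t]`. -/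
def quatLoc (S₀ : Set F) (c : F) : ℍ[F[X], C c, X] →+* QAS F S₀ c :=
  quatMap (algebraMap F[X] (OS F S₀)) rfl rfl

lemma quatLoc_algebraMap (p : F[X]) :
    quatLoc S₀ c (algebraMap _ _ p) = algebraMap (OS F S₀) _ (algebraMap F[X] (OS F S₀) p) :=
  quatMap_algebraMap _ _ p

lemma exists_quatLoc (w : QAS F S₀ c) : ∃ (m : F[X]) (w₀ : ℍ[F[X], C c, X]), m ∈ sden F S₀ ∧
    quatLoc S₀ c w₀ = algebraMap (OS F S₀) _ (algebraMap F[X] (OS F S₀) m) * w := by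
  obtain ⟨⟨m, hm⟩, h⟩ := IsLocalization.exist_integer_multiples_of_finite (sden F S₀)
    (QuaternionAlgebra.equivTuple _ _ _ w)
  choose p hp using h
  refine ⟨m, ⟨p 0, p 1, p 2, p 3⟩, hm, ?_⟩
  rw [← Algebra.smul_def]
  ext1
  · simpa [Algebra.smul_def, quatLoc, quatMap] using hp 0
  · simpa [Algebra.smul_def, quatLoc, quatMap] using hp 1
  · simpa [Algebra.smul_def, quatLoc, quatMap] using hp 2
  · simpa [Algebra.smul_def, quatLoc, quatMap] using hp 3

/-- A subgroup of `ℍ[o_S, c, t]ˣ` containing the scalars, the constants, `j` and all `1 + α·j`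
with `N(α)⁻¹ ∈ S₀` is everything. -/
lemma eq_top_of_generators_mem (hc : ¬IsSquare c) (K : Subgroup (QAS F S₀ c)ˣ)
    (hscalar : ∀ (w : (QAS F S₀ c)ˣ) r, (w : QAS F S₀ c) = algebraMap (OS F S₀) _ r → w ∈ K)
    (hconst : ∀ (w : (QAS F S₀ c)ˣ) x y, (w : QAS F S₀ c) = quatLoc S₀ c (constQ c x y) → w ∈ K)
    (hj : ∃ w ∈ K, (w : QAS F S₀ c) = quatLoc S₀ c (jQ c))
    (hletter : ∀ τ ∈ S₀, ∀ x y, τ * (x ^ 2 - c * y ^ 2) = 1 →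
      ∃ w ∈ K, (w : QAS F S₀ c) = quatLoc S₀ c (letterQ c x y)) : K = ⊤ := by
  have main : ∀ (n : ℕ) (w₀ : ℍ[F[X], C c, X]), (redNorm w₀).natDegree = n →
      ∀ w : (QAS F S₀ c)ˣ, (w : QAS F S₀ c) = quatLoc S₀ c w₀ → w ∈ K := by
    intro n
    induction n using Nat.strong_induction_on with
    | _ n ih =>
    intro w₀ hn w hw
    have hunit : IsUnit (algebraMap F[X] (OS F S₀) (redNorm w₀)) := by
      rw [← redNorm_quatMap (algebraMap F[X] (OS F S₀)) rfl rfl w₀]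
      exact isUnit_redNorm (hw ▸ w.isUnit)
    have step : ∀ (τ : F) (g : (QAS F S₀ c)ˣ) (g₀ : ℍ[F[X], C c, X]), (τ = 0 ∨ τ ∈ S₀) → g ∈ K →
        (g : QAS F S₀ c) = quatLoc S₀ c g₀ → (redNorm g₀).natDegree ≤ 1 →
        quatEval c τ (w₀ * g₀) = 0 → w ∈ K := by
      intro τ g g₀ hτ hgK hg hdeg hev
      obtain ⟨w₁, hw₁⟩ := exists_of_quatEval_eq_zero hev
      obtain ⟨r, hr⟩ := (isUnit_algebraMap_X_sub_C (S₀ := S₀) hτ).map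
        (algebraMap (OS F S₀) (QAS F S₀ c))
      have hrK : r ∈ K := hscalar r _ hr
      have hval : ((r⁻¹ * (w * g) : (QAS F S₀ c)ˣ) : QAS F S₀ c) = quatLoc S₀ c w₁ := by
        rw [Units.val_mul, Units.val_mul, hw, hg, ← map_mul, hw₁, map_mul, quatLoc_algebraMap,
          ← hr, Units.inv_mul_cancel_left]
      have hnorm := congrArg redNorm hw₁
      rw [redNorm_mul, redNorm_mul, redNorm_algebraMap] at hnorm
      have hne : redNorm w₀ * redNorm g₀ ≠ 0 := by
        have hg0 : IsUnit (algebraMap F[X] (OS F S₀) (redNorm g₀)) := by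
          rw [← redNorm_quatMap (algebraMap F[X] (OS F S₀)) rfl rfl g₀]
          exact isUnit_redNorm (hg ▸ g.isUnit)
        intro h
        have := hunit.mul hg0
        rw [← map_mul, h, map_zero] at this
        exact not_isUnit_zero this
      have hne' := hne
      rw [hnorm] at hne'
      have hdeg' := congrArg natDegree hnorm
      rw [natDegree_mul (left_ne_zero_of_mul hne) (right_ne_zero_of_mul hne),
        natDegree_mul (left_ne_zero_of_mul hne') (right_ne_zero_of_mul hne'), natDegree_pow,
        natDegree_X_sub_C] at hdeg'
      have hmem := ih _ (by lia) w₁ rfl _ hval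
      exact (K.mul_mem_cancel_right hgK).1 ((K.mul_mem_cancel_left (K.inv_mem hrK)).1 hmem)
    by_cases hroot : ∃ τ, (τ = 0 ∨ τ ∈ S₀) ∧ (redNorm w₀).eval τ = 0
    · obtain ⟨τ, hτ, hev⟩ := hroot
      by_cases hτ0 : τ = 0
      · subst hτ0
        obtain ⟨g, hgK, hg⟩ := hj
        exact step 0 g (jQ c) hτ hgK hg (by simp) (quatEval_mul_jQ_eq_zero hc hev)
      · rcases quatEval_eq_zero_or hc hτ0 hev with h | ⟨x, y, hxy, h⟩
        · exact step τ 1 1 hτ K.one_mem (by simp) (by simp) (by simpa using h)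
        · obtain ⟨g, hgK, hg⟩ := hletter τ (hτ.resolve_left hτ0) x y hxy
          refine step τ g _ hτ hgK hg ?_ h
          rw [redNorm_letterQ]
          compute_degree
    · push Not at hroot
      obtain ⟨r, hr, hr'⟩ := isUnit_iff.1 (isUnit_of_isUnit_algebraMap_OS hunit hroot)
      obtain ⟨x, y, rfl⟩ := eq_constQ_of_redNorm hc hr.ne_zero hr'.symm
      exact hconst w x y hw
  rw [eq_top_iff]
  intro w _
  obtain ⟨m, w₀, hm, hw₀⟩ := exists_quatLoc (w : QAS F S₀ c)
  obtain ⟨r, hr⟩ := (IsLocalization.map_units (OS F S₀) (⟨m, hm⟩ : sden F S₀)).map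
    (algebraMap (OS F S₀) (QAS F S₀ c))
  have := main _ w₀ rfl (r * w) (by rw [hw₀, ← hr, Units.val_mul])
  exact (K.mul_mem_cancel_left (hscalar r _ hr)).1 this

end Surjectivity

section NormalForm

variable {G I : Type*} [Group G] {a : I → G}

lemma exists_prod_conj {x : G} (h : ∀ i, ∃ j, x * a i * x⁻¹ = a j) (L : List I) :
    ∃ L' : List I, x * (L.map a).prod = (L'.map a).prod * x := by
  induction L with
  | nil => exact ⟨[], by simp⟩
  | cons i L ih =>
    obtain ⟨j, hj⟩ := h i
    obtain ⟨L', hL'⟩ := ih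
    refine ⟨j :: L', ?_⟩
    rw [List.map_cons, List.prod_cons, List.map_cons, List.prod_cons, mul_assoc, ← hL', ← hj]
    group

/-- In a group generated by `d`, `σ` and the `a i`, where `d` and `σ` generate a dihedral group
normalizing the set of the `a i`, every element is of the form `a i₁ ⋯ a iₘ * d ^ m * σ ^ ε`. -/
lemma exists_normal_form {d σ : G} {q : ℕ}
    (hgen : Subgroup.closure (Set.range a ∪ {d, σ}) = ⊤) (hd : d ^ (q + 1) = 1)
    (hσ : σ ^ 2 = 1) (hσd : (σ * d) ^ 2 = 1) (hσa : ∀ i, ∃ j, σ * a i * σ = a j)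
    (hda : ∀ i, ∃ j, d * a i * d⁻¹ = a j) (hinv : ∀ i, ∃ j, a j * a i = 1) (g : G) :
    ∃ (L : List I) (m ε : ℕ), ε < 2 ∧ g = (L.map a).prod * d ^ m * σ ^ ε := by
  have hσ' : σ⁻¹ = σ := by rw [inv_eq_iff_mul_eq_one, ← sq, hσ]
  have hd' : d⁻¹ = d ^ q := by rw [inv_eq_iff_mul_eq_one, ← pow_succ', hd]
  set P : G → Prop := fun g =>
    ∃ (L : List I) (m ε : ℕ), ε < 2 ∧ g = (L.map a).prod * d ^ m * σ ^ ε
  have ha : ∀ i y, P y → P (a i * y) := by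
    rintro i _ ⟨L, m, ε, hε, rfl⟩
    exact ⟨i :: L, m, ε, hε, by simp [mul_assoc]⟩
  have hdl : ∀ y, P y → P (d * y) := by
    rintro _ ⟨L, m, ε, hε, rfl⟩
    obtain ⟨L', hL'⟩ := exists_prod_conj hda L
    exact ⟨L', m + 1, ε, hε, by rw [← mul_assoc, ← mul_assoc, hL', pow_succ' d, mul_assoc _ d]⟩
  have hdpow : ∀ k y, P y → P (d ^ k * y) := by
    intro k y hy
    induction k with
    | zero => simpa using hy
    | succ k ih => rw [pow_succ', mul_assoc]; exact hdl _ ih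
  have hσl : ∀ y, P y → P (σ * y) := by
    rintro _ ⟨L, m, ε, hε, rfl⟩
    obtain ⟨L', hL'⟩ := exists_prod_conj (x := σ) (by simpa only [hσ'] using hσa) L
    have hconj : σ * d * σ⁻¹ = d⁻¹ := by
      rw [hσ', eq_inv_iff_mul_eq_one, mul_assoc, ← sq, hσd]
    have hpow : σ * d ^ m = d ^ (q * m) * σ := by
      rw [pow_mul, ← hd', ← hconj, conj_pow, inv_mul_cancel_right]
    have hε' : σ * σ ^ ε = σ ^ (1 - ε) := by
      have : ε = 0 ∨ ε = 1 := by lia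
      rcases this with rfl | rfl
      · simp
      · simpa [sq] using hσ
    refine ⟨L', q * m, 1 - ε, by lia, ?_⟩
    rw [← mul_assoc, ← mul_assoc, hL', mul_assoc _ σ, hpow, ← hε']
    simp only [mul_assoc]
  have hmem : g ∈ Subgroup.closure (Set.range a ∪ {d, σ}) := hgen ▸ Subgroup.mem_top g
  change P g
  induction hmem using Subgroup.closure_induction_left with
  | one => exact ⟨[], 0, 0, by simp, by simp⟩
  | mul_left x hx y _ hy =>
    rcases hx with ⟨i, rfl⟩ | rfl | rfl
    · exact ha i y hy
    · exact hdl y hy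
    · exact hσl y hy
  | inv_mul_cancel x hx y _ hy =>
    rcases hx with ⟨i, rfl⟩ | rfl | rfl
    · obtain ⟨j, hj⟩ := hinv i
      rw [← eq_inv_of_mul_eq_one_left hj]
      exact ha j y hy
    · rw [hd']
      exact hdpow q y hy
    · rw [hσ']
      exact hσl y hy

end NormalForm

section DiscreteExponential

variable {E : Type} [Field E] {δ : E} {n : ℕ}

lemma orderOf_eq_of_generator [Finite E] (hE : 2 < Nat.card E)
    (hδ : ∀ x : E, x ≠ 0 → ∃ m : ℕ, x = δ ^ m) : δ ≠ 0 ∧ orderOf δ = Nat.card E - 1 := by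
  have hδ0 : δ ≠ 0 := by
    rintro rfl
    have hsub : (Set.univ : Set E) ⊆ {0, 1} := by
      intro x _
      by_cases hx : x = 0
      · simp [hx]
      · obtain ⟨m, rfl⟩ := hδ x hx
        rcases Nat.eq_zero_or_pos m with rfl | hm
        · simp
        · simp [hm.ne'] at hx
    have hle := Set.ncard_le_ncard hsub
    rw [Set.ncard_univ, Set.ncard_pair zero_ne_one] at hle
    lia
  refine ⟨hδ0, ?_⟩
  have := orderOf_eq_card_of_forall_mem_powers (g := Units.mk0 δ hδ0) fun x => by
    obtain ⟨m, hm⟩ := hδ x x.ne_zero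
    exact ⟨m, Units.ext (by simp [hm])⟩
  rw [← Nat.card_units, ← this, ← orderOf_units, Units.val_mk0]

lemma pow_val_natCast (hn : orderOf δ = n) (k : ℕ) : δ ^ (k : ZMod n).val = δ ^ k := by
  rw [ZMod.val_natCast, ← hn, pow_mod_orderOf]

lemma pow_val_add [NeZero n] (hn : orderOf δ = n) (i j : ZMod n) :
    δ ^ (i + j).val = δ ^ i.val * δ ^ j.val := by
  rw [← pow_add, ← pow_val_natCast hn (i.val + j.val)]
  simp

lemma pow_val_natCast_mul [NeZero n] (hn : orderOf δ = n) (k : ℕ) (i : ZMod n) :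
    δ ^ ((k : ZMod n) * i).val = (δ ^ i.val) ^ k := by
  rw [← pow_mul, ← pow_val_natCast hn (i.val * k)]
  simp [mul_comm]

lemma pow_val_injective [NeZero n] (hn : orderOf δ = n) {i j : ZMod n}
    (h : δ ^ i.val = δ ^ j.val) : i = j := by
  apply ZMod.val_injective
  exact pow_injOn_Iio_orderOf (by simpa [hn] using i.val_lt) (by simpa [hn] using j.val_lt) h

/-- The exponents of elements of the same norm differ by a multiple of `q - 1`. -/
lemma exists_eq_add_mul {q : ℕ} (hq : 1 < q) (hnq : n = q ^ 2 - 1) (hn : orderOf δ = n)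
    (hδ : δ ≠ 0) {i j : ZMod n} (h : (δ ^ i.val) ^ (q + 1) = (δ ^ j.val) ^ (q + 1)) :
    ∃ k : ZMod n, i = j + k * ((q : ZMod n) - 1) := by
  have hfac : n = (q - 1) * (q + 1) := by
    rw [hnq, mul_comm, ← Nat.sq_sub_sq, one_pow]
  have hpos : n ≠ 0 := by
    rw [hfac]; exact Nat.mul_ne_zero (by lia) (by lia)
  have : NeZero n := ⟨hpos⟩
  have h1 : δ ^ ((i - j).val * (q + 1)) = 1 := by
    have hij := pow_val_add hn (i - j) j
    rw [sub_add_cancel] at hij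
    rw [hij, mul_pow] at h
    rw [pow_mul]
    exact mul_right_cancel₀ (pow_ne_zero _ (pow_ne_zero _ hδ)) (h.trans (one_mul _).symm)
  obtain ⟨k, hk⟩ : q - 1 ∣ (i - j).val := by
    refine Nat.dvd_of_mul_dvd_mul_right (Nat.succ_pos q) ?_
    exact (dvd_of_eq (hfac.symm.trans hn.symm)).trans (orderOf_dvd_of_pow_eq_one h1)
  refine ⟨k, ?_⟩
  have : i - j = ((q - 1) * k : ℕ) := by rw [← hk]; simp
  rw [← sub_eq_iff_eq_add', this, Nat.cast_mul, Nat.cast_sub hq.le, Nat.cast_one, mul_comm]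

/-- The elements `α' = δ^k` and `β' = δ^l` of the exchange relation satisfy `α' + β' = α + β` and
`α'·β'^q = α·β^q`. -/
lemma exchange_identities {q : ℕ} {α β ξ η α' β' : E} (hα2 : α ^ (q ^ 2) = α)
    (hx : ξ * α = α + β) (hy : η * β = α + β)
    (hfrob : (α + β) ^ q = α ^ q + β ^ q) (hγ2 : (α + β) ^ (q ^ 2) = α + β)
    (hα' : α' * η ^ q = β * η) (hβ' : β' * ξ ^ q = α * ξ) (hαβ : α + β ≠ 0) :
    α' + β' = α + β ∧ α' * β' ^ q = α * β ^ q := by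
  have h1 : α' * (α + β) ^ q = β ^ q * (α + β) := by
    rw [← hy, mul_pow]; linear_combination β ^ q * hα'
  have h2 : β' * (α + β) ^ q = α ^ q * (α + β) := by
    rw [← hx, mul_pow]; linear_combination α ^ q * hβ'
  have hne : (α + β) ^ q ≠ 0 := pow_ne_zero _ hαβ
  have h3 : β' ^ q * (α + β) = α * (α + β) ^ q := by
    have := congrArg (· ^ q) h2
    simp only [mul_pow, ← pow_mul, ← sq, hα2, hγ2] at this
    exact this
  refine ⟨mul_right_cancel₀ hne ?_, mul_right_cancel₀ (mul_ne_zero hne hαβ) ?_⟩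
  · rw [add_mul, h1, h2]
    linear_combination -(α + β) * hfrob
  · linear_combination β' ^ q * (α + β) * h1 + β ^ q * (α + β) * h3

end DiscreteExponential

section Classes

variable {F : Type} [Field F] {S₀ : Set F} {c : F}

lemma clsS_eq {w w' : (QAS F S₀ c)ˣ} {z z' : ℍ[F[X], C c, X]} {p : F[X]}
    (hw : (w : QAS F S₀ c) = quatLoc S₀ c z) (hw' : (w' : QAS F S₀ c) = quatLoc S₀ c z')
    (h : z = algebraMap _ _ p * z') : clsS F S₀ c w = clsS F S₀ c w' := by
  have hval : (w : QAS F S₀ c) = algebraMap (OS F S₀) _ (algebraMap F[X] (OS F S₀) p) * w' := by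
    rw [hw, h, map_mul, quatLoc_algebraMap, hw']
  have hunit : IsUnit (algebraMap F[X] (OS F S₀) p) := by
    apply isUnit_of_isUnit_algebraMap (a := algebraMap F[X] (OS F S₀) (C c))
      (b := algebraMap F[X] (OS F S₀) X)
    have := (w * w'⁻¹).isUnit
    rwa [Units.val_mul, hval, Units.mul_inv_cancel_right] at this
  obtain ⟨r, hr⟩ := hunit
  have h1 : clsS F S₀ c (Units.map (algebraMap (OS F S₀) (QAS F S₀ c)).toMonoidHom r) = 1 :=
    (QuotientGroup.eq_one_iff _).2 ⟨r, rfl⟩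
  rw [show w = Units.map (algebraMap (OS F S₀) (QAS F S₀ c)).toMonoidHom r * w' from
    Units.ext (by simp [hval, hr]), map_mul, h1, one_mul]

lemma clsS_eq_one {w : (QAS F S₀ c)ˣ} {z : ℍ[F[X], C c, X]} {p : F[X]}
    (hw : (w : QAS F S₀ c) = quatLoc S₀ c z) (h : z = algebraMap _ _ p) : clsS F S₀ c w = 1 := by
  rw [← map_one (clsS F S₀ c)]
  exact clsS_eq (z' := 1) hw (by simp) (by rw [mul_one, h])

lemma eq_algebraMap_of_clsS_eq_one {w : (QAS F S₀ c)ˣ} (h : clsS F S₀ c w = 1) :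
    ∃ r, (w : QAS F S₀ c) = algebraMap (OS F S₀) _ r := by
  obtain ⟨r, rfl⟩ := (QuotientGroup.eq_one_iff _).1 h
  exact ⟨r, rfl⟩

lemma clsS_eq_one_of_eq_algebraMap {w : (QAS F S₀ c)ˣ} {r : OS F S₀}
    (h : (w : QAS F S₀ c) = algebraMap (OS F S₀) _ r) : clsS F S₀ c w = 1 := by
  obtain ⟨r, rfl⟩ : IsUnit r := isUnit_of_isUnit_algebraMap
    (a := algebraMap F[X] (OS F S₀) (C c)) (b := algebraMap F[X] (OS F S₀) X) (h ▸ w.isUnit)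
  exact (QuotientGroup.eq_one_iff _).2 ⟨r, Units.ext h.symm⟩

lemma oneAddJ_eq (x y : F) : oneAddJ F S₀ c x y = quatLoc S₀ c (letterQ c x y) := by
  ext <;> simp [oneAddJ, quatLoc, quatMap, letterQ, toOS]

lemma scalarQ_eq (x y : F) : scalarQ F S₀ c x y = quatLoc S₀ c (constQ c x y) := by
  ext <;> simp [scalarQ, quatLoc, quatMap, constQ, toOS]

lemma jquat_eq : jquat F S₀ c = quatLoc S₀ c (jQ c) := by
  ext <;> simp [jquat, quatLoc, quatMap, jQ]

end Classes

/-- The concrete model `Λ_{M,δ}` is isomorphic to `Λ_S`,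
via `d ↦ [δ]`, `s ↦ [j]`, `a_i ↦ [1 + δ^i·j]`. -/
theorem lambdaS_concrete_model
    (F : Type) [Field F] [Fintype F] (hq : Odd (Fintype.card F))
    (c : F) (hc : ¬IsSquare c)
    (E : Type) [Field E] [Algebra F E] (s : E)
    (hs : s ^ 2 = algebraMap F E c)
    (hspan : ∀ α : E, ∃ x y : F, hasCoord F E s α x y)
    -- δ, a generator of the multiplicative group of `𝔽_{q²}`
    (δ : E) (hδ : ∀ x : E, x ≠ 0 → ∃ m : ℕ, x = δ ^ m)
    (n : ℕ) (hn : n = Fintype.card F ^ 2 - 1)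
    -- M, a union of cosets of `(q-1)ℤ/(q²-1)ℤ`
    (M : Set (ZMod n)) (hM : ∀ i ∈ M, i + ((Fintype.card F : ZMod n) - 1) ∈ M)
    -- the discrete logarithms `x_{i,j}`: `δ^{x_{i,j}} = 1 + δ^{j-i}`
    (xf : ZMod n → ZMod n → ZMod n)
    (hxf : ∀ i j : ZMod n,
      (i - j) ∉ AddSubgroup.zmultiples ((Fintype.card F : ZMod n) - 1) →
      δ ^ (xf i j).val = 1 + δ ^ (j - i).val)
    -- `k(i,j) = j - y_{i,j}(q-1)` with `y_{i,j} = x_{i,j} + i - j`, and `l(i,j) = i - x_{i,j}(q-1)`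
    (kf lf : ZMod n → ZMod n → ZMod n)
    (hkf : ∀ i j : ZMod n, kf i j = j - (xf i j + i - j) * ((Fintype.card F : ZMod n) - 1))
    (hlf : ∀ i j : ZMod n, lf i j = i - xf i j * ((Fintype.card F : ZMod n) - 1))
    -- the unit `δ = u + v·i` and the unit `j`
    (u v : F) (hδcoord : hasCoord F E s δ u v)
    (du : (QAS F (SofM F E δ n M) c)ˣ)
    (hdu : (du : QAS F (SofM F E δ n M) c) = scalarQ F (SofM F E δ n M) c u v)
    (su : (QAS F (SofM F E δ n M) c)ˣ)
    (hsu : (su : QAS F (SofM F E δ n M) c) = jquat F (SofM F E δ n M) c)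
    -- the units `1 + δ^i·j` for `i ∈ M`, with coordinates `δ^i = ax i + (ay i)·√c`
    (ax ay : {x : ZMod n // x ∈ M} → F)
    (haxy : ∀ i : {x : ZMod n // x ∈ M}, hasCoord F E s (δ ^ (i : ZMod n).val) (ax i) (ay i))
    (aw : {x : ZMod n // x ∈ M} → (QAS F (SofM F E δ n M) c)ˣ)
    (haw : ∀ i, (aw i : QAS F (SofM F E δ n M) c) = oneAddJ F (SofM F E δ n M) c (ax i) (ay i)) :
    ∃ iso : PresentedGroup (relsLM (Fintype.card F) n M kf lf) ≃*
        LambdaS F (SofM F E δ n M) c,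
      iso (PresentedGroup.of GenM.d) = clsS F (SofM F E δ n M) c du ∧
      iso (PresentedGroup.of GenM.s) = clsS F (SofM F E δ n M) c su ∧
      ∀ i, iso (PresentedGroup.of (GenM.a i)) = clsS F (SofM F E δ n M) c (aw i) := by
  set q := Fintype.card F
  have hq3 : 2 < q := by
    have h1 : 1 < q := Fintype.one_lt_card
    obtain ⟨m, hm⟩ := hq
    lia
  have hcard : Nat.card E = q ^ 2 := natCard_quadratic hc hs hspan
  have hq2 : 2 < q ^ 2 := by nlinarith
  have hfinE : Finite E := Nat.finite_of_card_ne_zero (by lia)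
  have := Fintype.ofFinite E
  obtain ⟨hδ0, horder⟩ := orderOf_eq_of_generator (by lia) hδ
  rw [hcard, ← hn] at horder
  have hn0 : NeZero n := ⟨by lia⟩
  have hpowq2 : ∀ α : E, α ^ (q ^ 2) = α := fun α => by
    rw [← hcard, Nat.card_eq_fintype_card, FiniteField.pow_card]
  have he0 : ∀ i : ZMod n, δ ^ i.val ≠ 0 := fun i => pow_ne_zero _ hδ0
  have hqcast : ((q - 1 : ℕ) : ZMod n) = (q : ZMod n) - 1 := by
    rw [Nat.cast_sub (by lia), Nat.cast_one]
  have hMmul : ∀ i ∈ M, ∀ k : ZMod n, i + k * ((q : ZMod n) - 1) ∈ M := by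
    intro i hi k
    rw [← ZMod.natCast_zmod_val k]
    induction k.val with
    | zero => simpa using hi
    | succ m ih => simpa [add_mul, add_assoc] using hM _ ih
  have hfac : n = (q - 1) * (q + 1) := by
    rw [hn, mul_comm, ← Nat.sq_sub_sq, one_pow]
  -- norms of the letters
  have hnorm_add : ∀ i k : ZMod n,
      (δ ^ (i + k * ((q : ZMod n) - 1)).val) ^ (q + 1) = (δ ^ i.val) ^ (q + 1) := by
    intro i k
    have hk : (δ ^ (k * ((q : ZMod n) - 1)).val) ^ (q + 1) = 1 := by
      rw [mul_comm, ← hqcast, pow_val_natCast_mul horder, ← pow_mul, ← hfac, ← pow_mul, mul_comm,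
        pow_mul, orderOf_dvd_iff_pow_eq_one.1 horder.dvd, one_pow]
    rw [pow_val_add horder, mul_pow, hk, mul_one]
  have hnorm : ∀ i : {x : ZMod n // x ∈ M},
      algebraMap F E (ax i ^ 2 - c * ay i ^ 2) = (δ ^ (i : ZMod n).val) ^ (q + 1) :=
    fun i => coord_norm hq hc hs (haxy i)
  have hfrob : ∀ {α : E} {x y : F}, hasCoord F E s α x y → hasCoord F E s (α ^ q) x (-y) := by
    intro α x y h
    rw [hasCoord, h, coord_pow_card hq hc hs, map_neg]
    ring
  -- the values of the generators
  have hdu' := hdu.trans (scalarQ_eq u v)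
  have hsu' := hsu.trans jquat_eq
  have haw' := fun i => (haw i).trans (oneAddJ_eq (ax i) (ay i))
  have hhalf : δ ^ (n / 2) = -1 := by
    have heven : 2 * (n / 2) = n := by
      obtain ⟨m, hm⟩ := hq
      have : n = 2 * (2 * m ^ 2 + 2 * m) := by
        rw [hn, hm]
        apply Nat.sub_eq_of_eq_add
        ring
      lia
    have hsq : (δ ^ (n / 2)) ^ 2 = 1 := by
      rw [← pow_mul, mul_comm, heven, ← horder, pow_orderOf_eq_one]
    refine (sq_eq_one_iff.1 hsq).resolve_left ?_
    intro h
    have := Nat.le_of_dvd (by lia) (orderOf_dvd_of_pow_eq_one h)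
    lia
  have hneg : ∀ i j : ZMod n, δ ^ j.val = -δ ^ i.val ↔ j = i + ((n / 2 : ℕ) : ZMod n) := by
    intro i j
    have h : δ ^ (i + ((n / 2 : ℕ) : ZMod n)).val = -δ ^ i.val := by
      rw [pow_val_add horder, pow_val_natCast horder, hhalf, mul_neg_one]
    exact ⟨fun hj => pow_val_injective horder (hj.trans h.symm), fun hj => hj ▸ h⟩
  have hMneg : ∀ i ∈ M, i + ((n / 2 : ℕ) : ZMod n) ∈ M := by
    intro i hi
    obtain ⟨k, hk⟩ := exists_eq_add_mul (by lia) hn horder hδ0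
      (i := i + ((n / 2 : ℕ) : ZMod n)) (j := i) (by
        rw [(hneg i _).2 rfl, neg_pow, Even.neg_one_pow hq.add_one, one_mul])
    exact hk ▸ hMmul i hi k
  have hexch : ∀ i j k l : {x : ZMod n // x ∈ M},
      (i : ZMod n) - (j : ZMod n) ∉ AddSubgroup.zmultiples ((q : ZMod n) - 1) →
      (k : ZMod n) = kf i j → (l : ZMod n) = lf i j →
      letterQ c (ax i) (ay i) * letterQ c (ax j) (ay j) =
        letterQ c (ax k) (ay k) * letterQ c (ax l) (ay l) := by
    intro i j k l hij hk hl
    set α := δ ^ (i : ZMod n).val with hα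
    set β := δ ^ (j : ZMod n).val with hβ
    set ξ := δ ^ (xf i j).val with hξ
    set η := δ ^ (xf i j + i - j).val with hη
    have hx : ξ * α = α + β := by
      have h : δ ^ ((j : ZMod n) - i).val * α = β := by
        rw [hα, ← pow_val_add horder, sub_add_cancel]
      rw [hξ, hxf i j hij, add_mul, one_mul, h]
    have hy : η * β = α + β := by
      rw [← hx, hη, hβ, hξ, hα, ← pow_val_add horder, ← pow_val_add horder, sub_add_cancel]
    have hsum0 : α + β ≠ 0 := hx ▸ mul_ne_zero (he0 _) (he0 _)
    have hk' : δ ^ (k : ZMod n).val * η ^ q = β * η := by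
      rw [hη, hβ, ← pow_val_natCast_mul horder, ← pow_val_add horder, ← pow_val_add horder, hk, hkf]
      congr 2
      ring
    have hl' : δ ^ (l : ZMod n).val * ξ ^ q = α * ξ := by
      rw [hξ, hα, ← pow_val_natCast_mul horder, ← pow_val_add horder, ← pow_val_add horder, hl, hlf]
      congr 2
      ring
    have hfr : (α + β) ^ q = α ^ q + β ^ q := by
      have h : hasCoord F E s (α + β) (ax i + ax j) (ay i + ay j) := by
        rw [hasCoord, hα, hβ, haxy i, haxy j]
        simp only [map_add]
        ring
      rw [hfrob h, hfrob (haxy i), hfrob (haxy j)]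
      simp only [map_add, map_neg]
      ring
    obtain ⟨h1, h2⟩ := exchange_identities (hpowq2 α) hx hy hfr (hpowq2 _) hk' hl' hsum0
    rw [hfrob (haxy j), hfrob (haxy l), hα, haxy i, haxy k] at h2
    rw [hα, hβ, haxy i, haxy j, haxy k, haxy l] at h1
    obtain ⟨h3, h4⟩ := coord_unique (x := ax k + ax l) (y := ay k + ay l) (x' := ax i + ax j)
      (y' := ay i + ay j) hc hs (by simp only [map_add]; linear_combination h1)
    obtain ⟨h5, h6⟩ := coord_unique (x := ax k * ax l - c * ay k * ay l)
      (y := ay k * ax l - ax k * ay l) (x' := ax i * ax j - c * ay i * ay j)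
      (y' := ay i * ax j - ax i * ay j) hc hs (by
        simp only [map_sub, map_mul, ← hs]
        simp only [map_neg] at h2
        linear_combination h2)
    have h3 := congrArg C h3
    have h4 := congrArg C h4
    have h5 := congrArg C h5
    have h6 := congrArg C h6
    simp only [map_add, map_sub, map_mul] at h3 h4 h5 h6
    ext1 <;> simp [letterQ]
    · linear_combination -X * h5
    · linear_combination -X * h6
    · linear_combination -h3
    · linear_combination -h4
  have hcancel : ∀ i j : {x : ZMod n // x ∈ M}, δ ^ (j : ZMod n).val = -δ ^ (i : ZMod n).val →
      letterQ c (ax j) (ay j) * letterQ c (ax i) (ay i) =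
        algebraMap F[X] _ (1 - X * C (ax i ^ 2 - c * ay i ^ 2)) := by
    intro i j h
    rw [haxy i, haxy j] at h
    obtain ⟨hx, hy⟩ := coord_unique (x' := -ax i) (y' := -ay i) hc hs (h.trans (by
      simp only [map_neg]; ring))
    rw [hx, hy, QuaternionAlgebra.algebraMap_eq]
    ext1 <;> simp [letterQ] <;> ring
  have hconj_s : ∀ i j : {x : ZMod n // x ∈ M}, (j : ZMod n) = (q : ZMod n) * (i : ZMod n) →
      jQ c * letterQ c (ax i) (ay i) * jQ c =
        algebraMap F[X] _ X * letterQ c (ax j) (ay j) := by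
    intro i j h
    have h' : δ ^ (j : ZMod n).val = (δ ^ (i : ZMod n).val) ^ q := by
      rw [h, pow_val_natCast_mul horder]
    rw [haxy j, hfrob (haxy i)] at h'
    obtain ⟨hx, hy⟩ := coord_unique hc hs h'
    rw [hx, hy, QuaternionAlgebra.algebraMap_eq]
    ext1 <;> simp [letterQ, jQ]
  have hconj_d : ∀ i j : {x : ZMod n // x ∈ M}, (j : ZMod n) = (i : ZMod n) + 1 - (q : ZMod n) →
      constQ c u v * letterQ c (ax i) (ay i) = letterQ c (ax j) (ay j) * constQ c u v := by
    intro i j h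
    have h' : δ ^ (j : ZMod n).val * δ ^ q = δ ^ (i : ZMod n).val * δ := by
      rw [← pow_val_natCast horder q, ← pow_val_add horder, h, sub_add_cancel, pow_val_add horder,
        ← Nat.cast_one, pow_val_natCast horder, pow_one]
    rw [hfrob hδcoord, haxy j, haxy i, hδcoord] at h'
    obtain ⟨h1, h2⟩ := coord_unique (x := ax j * u - c * ay j * v) (y := ay j * u - ax j * v)
      (x' := ax i * u + c * ay i * v) (y' := ay i * u + ax i * v) hc hs (by
        simp only [map_add, map_sub, map_mul, ← hs]
        simp only [map_neg] at h'
        linear_combination h')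
    have h1 := congrArg C h1
    have h2 := congrArg C h2
    simp only [map_add, map_sub, map_mul] at h1 h2
    ext1 <;> simp [letterQ, constQ]
    · linear_combination -h1
    · linear_combination -h2
  -- the homomorphism
  let f : GenM n M → LambdaS F (SofM F E δ n M) c := fun g => match g with
    | GenM.d => clsS F _ c du
    | GenM.s => clsS F _ c su
    | GenM.a i => clsS F _ c (aw i)
  have hmulval : ∀ {w w' : (QAS F (SofM F E δ n M) c)ˣ} {z z' : ℍ[F[X], C c, X]},
      (w : QAS F (SofM F E δ n M) c) = quatLoc _ c z →
      (w' : QAS F (SofM F E δ n M) c) = quatLoc _ c z' →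
      ((w * w' : (QAS F (SofM F E δ n M) c)ˣ) : QAS F (SofM F E δ n M) c) =
        quatLoc _ c (z * z') := fun h h' => by rw [Units.val_mul, h, h', map_mul]
  have hpowval : ∀ {w : (QAS F (SofM F E δ n M) c)ˣ} {z : ℍ[F[X], C c, X]} (m : ℕ),
      (w : QAS F (SofM F E δ n M) c) = quatLoc _ c z →
      ((w ^ m : (QAS F (SofM F E δ n M) c)ˣ) : QAS F (SofM F E δ n M) c) =
        quatLoc _ c (z ^ m) := fun m h => by rw [Units.val_pow_eq_pow_val, h, map_pow]
  have hrel : ∀ r ∈ relsLM q n M kf lf, FreeGroup.lift f r = 1 := by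
    rintro r ((((hr | ⟨i, j, hij, rfl⟩) | ⟨i, j, hij, rfl⟩) | ⟨i, j, hij, rfl⟩) |
      ⟨i, j, k, l, hij, hk, hl, rfl⟩)
    · rcases hr with rfl | rfl | rfl
      · simp only [map_pow, FreeGroup.lift_apply_of, f]
        rw [← map_pow]
        refine clsS_eq_one (p := C (u ^ 2 - c * v ^ 2)) (hpowval _ hdu') ?_
        have h : hasCoord F E s (δ ^ (q + 1)) (u ^ 2 - c * v ^ 2) 0 := by
          rw [hasCoord, map_zero, zero_mul, add_zero, coord_norm hq hc hs hδcoord]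
        rw [constQ_pow hc hs hδcoord h, QuaternionAlgebra.algebraMap_eq, constQ, map_zero]
      · simp only [map_pow, FreeGroup.lift_apply_of, f]
        rw [← map_pow]
        refine clsS_eq_one (p := X) (hpowval _ hsu') ?_
        rw [QuaternionAlgebra.algebraMap_eq, sq]
        ext1 <;> simp [jQ]
      · simp only [map_pow, map_mul, FreeGroup.lift_apply_of, f]
        rw [← map_mul, ← map_pow]
        refine clsS_eq_one (p := X * C (u ^ 2 - c * v ^ 2)) (hpowval _ (hmulval hsu' hdu')) ?_
        rw [QuaternionAlgebra.algebraMap_eq, sq]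
        ext1 <;> simp [jQ, constQ] <;> ring
    · simp only [map_mul, map_inv, FreeGroup.lift_apply_of, f]
      rw [mul_inv_eq_one, ← map_mul, ← map_mul]
      exact clsS_eq (hmulval (hmulval hsu' (haw' i)) hsu') (haw' j) (hconj_s i j hij)
    · simp only [map_mul, map_inv, FreeGroup.lift_apply_of, f]
      rw [mul_inv_eq_one, mul_inv_eq_iff_eq_mul, ← map_mul, ← map_mul]
      refine clsS_eq (p := 1) (hmulval hdu' (haw' i)) (hmulval (haw' j) hdu') ?_
      rw [map_one, one_mul, hconj_d i j hij]
    · simp only [map_mul, FreeGroup.lift_apply_of, f]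
      rw [← map_mul]
      exact clsS_eq_one (hmulval (haw' j) (haw' i)) (hcancel i j ((hneg _ _).2 hij))
    · simp only [map_mul, map_inv, FreeGroup.lift_apply_of, f]
      rw [mul_inv_eq_iff_eq_mul, one_mul, ← map_mul, ← map_mul]
      refine clsS_eq (p := 1) (hmulval (haw' i) (haw' j)) (hmulval (haw' k) (haw' l)) ?_
      rw [map_one, one_mul, hexch i j k l hij hk hl]
  let φ := PresentedGroup.toGroup hrel
  have hφd : φ (PresentedGroup.of GenM.d) = clsS F _ c du := PresentedGroup.toGroup.of hrel
  have hφs : φ (PresentedGroup.of GenM.s) = clsS F _ c su := PresentedGroup.toGroup.of hrel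
  have hφa : ∀ i, φ (PresentedGroup.of (GenM.a i)) = clsS F _ c (aw i) :=
    fun i => PresentedGroup.toGroup.of hrel
  -- the relations in the presented group
  let d : PresentedGroup (relsLM q n M kf lf) := PresentedGroup.of GenM.d
  let σ : PresentedGroup (relsLM q n M kf lf) := PresentedGroup.of GenM.s
  let a : {x : ZMod n // x ∈ M} → PresentedGroup (relsLM q n M kf lf) :=
    fun i => PresentedGroup.of (GenM.a i)
  have hd : d ^ (q + 1) = 1 :=
    PresentedGroup.one_of_mem (Or.inl (Or.inl (Or.inl (Or.inl (Or.inl rfl)))))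
  have hσ : σ ^ 2 = 1 :=
    PresentedGroup.one_of_mem (Or.inl (Or.inl (Or.inl (Or.inl (Or.inr (Or.inl rfl))))))
  have hσd : (σ * d) ^ 2 = 1 :=
    PresentedGroup.one_of_mem (Or.inl (Or.inl (Or.inl (Or.inl (Or.inr (Or.inr rfl))))))
  have hσa : ∀ i, ∃ j, σ * a i * σ = a j := fun i => by
    have hj : (q : ZMod n) * i ∈ M := by
      rw [show (q : ZMod n) * i = i + i * (q - 1) by ring]
      exact hMmul i i.2 i
    exact ⟨⟨_, hj⟩, PresentedGroup.mk_eq_mk_of_mul_inv_mem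
      (Or.inl (Or.inl (Or.inl (Or.inr ⟨i, ⟨_, hj⟩, rfl, rfl⟩))))⟩
  have hda : ∀ i, ∃ j, d * a i * d⁻¹ = a j := fun i => by
    have hj : (i : ZMod n) + 1 - q ∈ M := by
      rw [show (i : ZMod n) + 1 - q = i + (-1) * (q - 1) by ring]
      exact hMmul i i.2 (-1)
    exact ⟨⟨_, hj⟩, PresentedGroup.mk_eq_mk_of_mul_inv_mem
      (Or.inl (Or.inl (Or.inr ⟨i, ⟨_, hj⟩, rfl, rfl⟩)))⟩
  have hinv : ∀ i j : {x : ZMod n // x ∈ M}, (j : ZMod n) = i + ((n / 2 : ℕ) : ZMod n) →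
      a j * a i = 1 := fun i j h =>
    PresentedGroup.one_of_mem (Or.inl (Or.inr ⟨i, j, h, rfl⟩))
  have hswap : ∀ i j k l : {x : ZMod n // x ∈ M},
      (i : ZMod n) - (j : ZMod n) ∉ AddSubgroup.zmultiples ((q : ZMod n) - 1) →
      (k : ZMod n) = kf i j → (l : ZMod n) = lf i j → a i * a j = a k * a l :=
    fun i j k l hij hk hl =>
      PresentedGroup.mk_eq_mk_of_mul_inv_mem (Or.inr ⟨i, j, k, l, hij, hk, hl, rfl⟩)
  have hgen : Subgroup.closure (Set.range a ∪ {d, σ}) = ⊤ := by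
    rw [eq_top_iff, ← PresentedGroup.closure_range_of (relsLM q n M kf lf)]
    apply Subgroup.closure_mono
    rintro _ ⟨g | g | i, rfl⟩
    · exact Or.inr (Or.inl rfl)
    · exact Or.inr (Or.inr rfl)
    · exact Or.inl ⟨i, rfl⟩
  have hinj : Function.Injective φ := by
    rw [injective_iff_map_eq_one]
    intro g hg
    obtain ⟨L, m, ε, hε, rfl⟩ := exists_normal_form hgen hd hσ hσd hσa hda
      (fun i => ⟨⟨_, hMneg i i.2⟩, hinv i _ rfl⟩) g
    refine word_eq_one hq hc hs haxy (fun i j hij => hinv j i ((hneg _ _).1 hij)) ?_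
      (fun i => he0 _) hδ0 hδcoord hspan ?_ φ ?_ m ε hε L hg
    · intro i j hij
      have hij' : (i : ZMod n) - (j : ZMod n) ∉ AddSubgroup.zmultiples ((q : ZMod n) - 1) := by
        rintro ⟨z, hz⟩
        apply hij
        apply (algebraMap F E).injective
        rw [hnorm, hnorm, ← hnorm_add j z, ← zsmul_eq_mul]
        congr 3
        rw [← sub_eq_iff_eq_add', ← hz]
      have hk : kf i j = j + -(xf i j + i - j) * ((q : ZMod n) - 1) := by rw [hkf]; ring
      have hl : lf i j = i + -xf i j * ((q : ZMod n) - 1) := by rw [hlf]; ring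
      have hkM : kf i j ∈ M := hk ▸ hMmul j j.2 _
      have hlM : lf i j ∈ M := hl ▸ hMmul i i.2 _
      refine ⟨⟨_, hkM⟩, ⟨_, hlM⟩, ?_, ?_, hswap i j ⟨_, hkM⟩ ⟨_, hlM⟩ hij' rfl rfl,
        hexch i j ⟨_, hkM⟩ ⟨_, hlM⟩ hij' rfl rfl⟩
      · apply (algebraMap F E).injective
        rw [hnorm, hnorm, ← hnorm_add j, ← hk]
      · apply (algebraMap F E).injective
        rw [hnorm, hnorm, ← hnorm_add i, ← hl]
    · intro m z hz
      have hz0 : z ≠ 0 := by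
        rintro rfl
        exact pow_ne_zero m hδ0 (hz.trans (map_zero _))
      have h1 : δ ^ (m * (q - 1)) = 1 := by
        rw [pow_mul, hz, ← map_pow, FiniteField.pow_card_sub_one_eq_one z hz0, map_one]
      have h2 := orderOf_dvd_of_pow_eq_one h1
      rw [horder, hfac, mul_comm] at h2
      obtain ⟨k, rfl⟩ := Nat.dvd_of_mul_dvd_mul_right (by lia) h2
      rw [pow_mul, hd, one_pow]
    · intro L m ε h
      have hword : φ ((L.map a).prod * d ^ m * σ ^ ε) =
          clsS F _ c ((L.map aw).prod * du ^ m * su ^ ε) := by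
        simp only [map_mul, map_pow, map_list_prod, List.map_map]
        rw [show φ d = _ from hφd, show φ σ = _ from hφs,
          show ⇑φ ∘ a = ⇑(clsS F _ c) ∘ aw from funext hφa]
      rw [hword] at h
      obtain ⟨r, hr⟩ := eq_algebraMap_of_clsS_eq_one h
      have hL : (((L.map aw).prod : (QAS F (SofM F E δ n M) c)ˣ) : QAS F (SofM F E δ n M) c) =
          quatLoc _ c (L.map fun i => letterQ c (ax i) (ay i)).prod := by
        clear h hword hr
        induction L with
        | nil => simp
        | cons i L ih =>
          simp only [List.map_cons, List.prod_cons]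
          exact hmulval (haw' i) ih
      rw [hmulval (hmulval hL (hpowval m hdu')) (hpowval ε hsu')] at hr
      exact ⟨_, eq_algebraMap_of_quatMap rfl rfl algebraMap_OS_injective hr⟩
  have hsurj : Function.Surjective φ := by
    have hK : φ.range.comap (clsS F (SofM F E δ n M) c) = ⊤ := by
      refine eq_top_of_generators_mem hc _ ?_ ?_ ⟨su, ⟨_, hφs⟩, hsu'⟩ ?_
      · intro w r hw
        rw [Subgroup.mem_comap, clsS_eq_one_of_eq_algebraMap hw]
        exact one_mem _
      · intro w x y hw
        obtain ⟨m, hm⟩ := hδ (algebraMap F E x + algebraMap F E y * s) fun h0 => by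
          obtain ⟨rfl, rfl⟩ := coord_eq_zero hc hs h0
          have hnt : (w : QAS F (SofM F E δ n M) c) = 0 := by
            rw [hw, show constQ c 0 0 = 0 by ext1 <;> simp [constQ], map_zero]
          exact w.ne_zero hnt
        refine ⟨PresentedGroup.of GenM.d ^ m, ?_⟩
        rw [map_pow, hφd, ← map_pow]
        congr 1
        exact Units.ext (by rw [hpowval m hdu', hw, constQ_pow hc hs hδcoord hm.symm])
      · rintro τ ⟨i, hi⟩ x y hxy
        have hxyN := coord_norm hq hc hs (rfl : hasCoord F E s _ x y)
        obtain ⟨m, hm⟩ := hδ (algebraMap F E x + algebraMap F E y * s) fun h0 => by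
          obtain ⟨rfl, rfl⟩ := coord_eq_zero hc hs h0
          simp at hxy
        have hm' : hasCoord F E s (δ ^ (m : ZMod n).val) x y := by
          rw [pow_val_natCast horder, ← hm]
          rfl
        obtain ⟨k, hk⟩ := exists_eq_add_mul (by lia) hn horder hδ0 (i := (m : ZMod n))
          (j := (i : ZMod n)) (by
            rw [← coord_norm hq hc hs hm', eq_inv_of_mul_eq_one_right hxy, map_inv₀, hi,
              inv_pow, inv_inv, pow_right_comm])
        have hmM : (m : ZMod n) ∈ M := hk ▸ hMmul i i.2 k
        obtain ⟨hx, hy⟩ := coord_unique hc hs ((haxy ⟨_, hmM⟩).symm.trans hm')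
        refine ⟨aw ⟨_, hmM⟩, ⟨_, hφa _⟩, ?_⟩
        rw [haw', hx, hy]
    intro g
    obtain ⟨w, rfl⟩ := QuotientGroup.mk'_surjective _ g
    have hw : w ∈ φ.range.comap (clsS F (SofM F E δ n M) c) := hK ▸ Subgroup.mem_top w
    exact hw
  exact ⟨MulEquiv.ofBijective φ ⟨hinj, hsurj⟩, hφd, hφs, hφa⟩
end
end

section
/- Let S₀ = {p₁, …, p_d} be a finite set of odd primes and ℤ_S = ℤ[1/(2p₁⋯p_d)]. Then the reduced norm w·star(w) of every unit w of ℍ[ℤ_S] is a positive unit of ℤ_S, and conversely every positive unit u of ℤ_S can be written as u = (w·star(w))·v² for some unit w of ℍ[ℤ_S] and some unit v of ℤ_S. Equivalently, the subgroup of ℤ_Sˣ/(ℤ_Sˣ)² consisting of classes of reduced norms of units of ℍ[ℤ_S] has index exactly 2. -/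
open Quaternion

noncomputable section

/-- The ring `ℤ_S = ℤ[1/(2·∏_{p∈S₀} p)]`, realized as the subring of `ℚ` generated by
`1/2` and `1/p` for `p ∈ S₀` (with the ordering inherited from `ℚ`). -/
def ZS (S₀ : Finset ℕ) : Subring ℚ :=
  Subring.closure ({(2 : ℚ)⁻¹} ∪ {x : ℚ | ∃ p ∈ S₀, x = (p : ℚ)⁻¹})

theorem Quaternion.normSq_pos_of_isUnit {R : Type*} [CommRing R] [LinearOrder R]
    [IsStrictOrderedRing R] {w : ℍ[R]} (hw : IsUnit w) : 0 < normSq w :=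
  lt_of_le_of_ne normSq_nonneg (hw.map normSq).ne_zero.symm

/-- A subring of `ℚ` containing `q` also contains the inverse of the denominator of `q`. -/
theorem Subring.inv_den_mem (A : Subring ℚ) {q : ℚ} (hq : q ∈ A) : (q.den : ℚ)⁻¹ ∈ A := by
  obtain ⟨x, y, hxy⟩ := Rat.isCoprime_num_den q
  have hden : (q.den : ℚ) ≠ 0 := Nat.cast_ne_zero.mpr q.den_nz
  have hcast : (x : ℚ) * q.num + y * q.den = 1 := by exact_mod_cast hxy
  have hinv : (q.den : ℚ)⁻¹ = x * q + y := by
    rw [inv_eq_one_div, div_eq_iff hden, ← hcast, ← Rat.mul_den_eq_num q]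
    ring
  rw [hinv]
  exact A.add_mem (A.mul_mem (intCast_mem A x) hq) (intCast_mem A y)

/-- A nonnegative rational number times the square of its denominator is a sum of four integer
squares. -/
theorem Rat.exists_sum_four_squares_eq_mul_den_sq {q : ℚ} (hq : 0 ≤ q) :
    ∃ a b c d : ℕ, (a : ℚ) ^ 2 + b ^ 2 + c ^ 2 + d ^ 2 = q * (q.den : ℚ) ^ 2 := by
  obtain ⟨a, b, c, d, h⟩ := Nat.sum_four_squares (q.num.toNat * q.den)
  have hnum : ((q.num.toNat : ℕ) : ℚ) = q.num := by
    exact_mod_cast Int.toNat_of_nonneg (Rat.num_nonneg.mpr hq)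
  have h' : (a : ℚ) ^ 2 + b ^ 2 + c ^ 2 + d ^ 2 = (q.num.toNat : ℚ) * q.den := by exact_mod_cast h
  refine ⟨a, b, c, d, ?_⟩
  rw [h', hnum, ← Rat.mul_den_eq_num q]
  ring

theorem Quaternion.isUnit_of_isUnit_normSq {R : Type*} [CommRing R] {w : ℍ[R]}
    (h : IsUnit (normSq w)) : IsUnit w := by
  have h' : IsUnit (w * star w) := by
    rw [self_mul_star]
    exact h.map (algebraMap R ℍ[R])
  exact ((Commute.isUnit_mul_iff (star_comm_self' w).symm).mp h').1

/-- The reduced norm of every unit of `ℍ[ℤ_S]` is a positive unit of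
`ℤ_S`, and conversely every positive unit `u` of `ℤ_S` is of the form `(w·star w)·v²`;
equivalently, the reduced norms of units have index exactly `2` in `ℤ_Sˣ/(ℤ_Sˣ)²`. -/
theorem hurwitz_reducedNorm_positive_units
    (S₀ : Finset ℕ) (hS₀ : ∀ p ∈ S₀, p.Prime ∧ Odd p) :
    -- reduced norms of units are positive units
    (∀ w : ℍ[(ZS S₀)]ˣ, ∃ ν : (ZS S₀)ˣ,
      (w : ℍ[(ZS S₀)]) * star (w : ℍ[(ZS S₀)]) =
        algebraMap (ZS S₀) ℍ[(ZS S₀)] (ν : ZS S₀) ∧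
      0 < ((ν : ZS S₀) : ℚ)) ∧
    -- every positive unit is a reduced norm times a square
    (∀ u : (ZS S₀)ˣ, 0 < ((u : ZS S₀) : ℚ) →
      ∃ (w : ℍ[(ZS S₀)]ˣ) (v : (ZS S₀)ˣ),
        (w : ℍ[(ZS S₀)]) * star (w : ℍ[(ZS S₀)]) =
          algebraMap (ZS S₀) ℍ[(ZS S₀)] ((u : ZS S₀) * (v : ZS S₀) ^ 2)) := by
  refine ⟨fun w => ⟨Units.map normSq.toMonoidHom w, self_mul_star _, ?_⟩, fun u hu => ?_⟩
  · exact_mod_cast normSq_pos_of_isUnit w.isUnit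
  · set q : ℚ := ((u : ZS S₀) : ℚ) with hq
    obtain ⟨a, b, c, d, h⟩ := Rat.exists_sum_four_squares_eq_mul_den_sq hu.le
    have hden : (q.den : ℚ) ≠ 0 := Nat.cast_ne_zero.mpr q.den_nz
    let v : (ZS S₀)ˣ :=
      ⟨(q.den : ZS S₀), ⟨(q.den : ℚ)⁻¹, (ZS S₀).inv_den_mem (u : ZS S₀).2⟩,
        Subtype.ext (by simp [hden]), Subtype.ext (by simp [hden])⟩
    let w : ℍ[(ZS S₀)] := ⟨a, b, c, d⟩
    have hw : normSq w = (u : ZS S₀) * (v : ZS S₀) ^ 2 := by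
      rw [normSq_def']
      apply Subtype.ext
      simpa [w, v] using h
    have hunit : IsUnit w := isUnit_of_isUnit_normSq (by
      rw [hw]
      exact (u * v ^ 2).isUnit)
    exact ⟨hunit.unit, v, by rw [IsUnit.unit_spec, self_mul_star, hw]; rfl⟩
end
end

section
/- Let p be an odd prime. If p ≡ 1 (mod 4), then the set of quadruples (a, b, c, d) ∈ ℤ⁴ with a² + b² + c² + d² = p, a odd, and b, c, d all even has exactly 2(p + 1) elements. If p ≡ 3 (mod 4), then the set of quadruples (a, b, c, d) ∈ ℤ⁴ with a² + b² + c² + d² = p, a even, and b, c, d all odd has exactly 2(p + 1) elements. -/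
open scoped Quaternion

namespace LipschitzQuaternion

open Matrix

section MatrixLemmas

variable {F : Type*} [Field F]

/-- Homogeneous coordinates of the points of the projective line over `F`, where `none` is the
point at infinity. -/
def projectivePoint : Option F → Fin 2 → F
  | none => ![1, 0]
  | some x => ![x, 1]

theorem projectivePoint_ne_zero (v : Option F) : projectivePoint v ≠ 0 := by
  intro h
  cases v with
  | none => simpa [projectivePoint] using congrFun h 0
  | some x => simpa [projectivePoint] using congrFun h 1

theorem mulVec_projectivePoint_eq_zero_iff (A : Matrix (Fin 2) (Fin 2) F) (v : Option F) :
    A *ᵥ projectivePoint v = 0 ↔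
      A 0 0 * projectivePoint v 0 + A 0 1 * projectivePoint v 1 = 0 ∧
      A 1 0 * projectivePoint v 0 + A 1 1 * projectivePoint v 1 = 0 := by
  rw [funext_iff, Fin.forall_fin_two]
  simp [mulVec, dotProduct, Fin.sum_univ_two]

/-- The kernel of a nonzero singular `2 × 2` matrix is exactly one point of the projective line. -/
theorem existsUnique_mulVec_projectivePoint_eq_zero {A : Matrix (Fin 2) (Fin 2) F} (hA : A ≠ 0)
    (hdet : A.det = 0) : ∃! v : Option F, A *ᵥ projectivePoint v = 0 := by
  have hne : ¬ (A 0 0 = 0 ∧ A 0 1 = 0 ∧ A 1 0 = 0 ∧ A 1 1 = 0) := by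
    rintro ⟨h1, h2, h3, h4⟩
    apply hA
    ext i j
    fin_cases i <;> fin_cases j <;> simpa
  rw [det_fin_two] at hdet
  have hfin (x : F) : A *ᵥ projectivePoint (some x) = 0 ↔
      A 0 0 * x + A 0 1 = 0 ∧ A 1 0 * x + A 1 1 = 0 := by
    simp [projectivePoint]
  have hinf : A *ᵥ projectivePoint none = 0 ↔ A 0 0 = 0 ∧ A 1 0 = 0 := by
    simp [projectivePoint]
  by_cases h : A 0 0 = 0 ∧ A 1 0 = 0
  · refine ⟨none, hinf.2 h, ?_⟩
    rintro (_ | x) hx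
    · rfl
    · have := (hfin x).1 hx
      grind
  · have hex : ∃ x : F, A 0 0 * x + A 0 1 = 0 ∧ A 1 0 * x + A 1 1 = 0 := by
      by_cases h0 : A 0 0 = 0
      · have h1 : A 1 0 ≠ 0 := fun h1 => h ⟨h0, h1⟩
        exact ⟨-A 1 1 / A 1 0, by grind, by grind⟩
      · exact ⟨-A 0 1 / A 0 0, by grind, by grind⟩
    obtain ⟨x, hx⟩ := hex
    refine ⟨some x, (hfin x).2 hx, ?_⟩
    rintro (_ | y) hy
    · exact absurd (hinf.1 hy) h
    · have := (hfin y).1 hy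
      grind

theorem mul_adjugate_eq_zero {A B : Matrix (Fin 2) (Fin 2) F} {v : Option F}
    (hA : A *ᵥ projectivePoint v = 0) (hB : B *ᵥ projectivePoint v = 0) :
    B * A.adjugate = 0 := by
  rw [mulVec_projectivePoint_eq_zero_iff] at hA hB
  rw [adjugate_fin_two]
  ext i j
  cases v <;> fin_cases i <;> fin_cases j <;>
    simp [projectivePoint, mul_apply, Fin.sum_univ_two] at hA hB ⊢ <;> grind

end MatrixLemmas

/-- The Lipschitz quaternion with given coordinates. -/
def ofCoords (a b c d : ℤ) : ℍ[ℤ] := ⟨a, b, c, d⟩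

@[simp] theorem re_ofCoords (a b c d : ℤ) : (ofCoords a b c d).re = a := rfl

@[simp] theorem imI_ofCoords (a b c d : ℤ) : (ofCoords a b c d).imI = b := rfl

@[simp] theorem imJ_ofCoords (a b c d : ℤ) : (ofCoords a b c d).imJ = c := rfl

@[simp] theorem imK_ofCoords (a b c d : ℤ) : (ofCoords a b c d).imK = d := rfl

@[simp] theorem normSq_ofCoords (a b c d : ℤ) :
    Quaternion.normSq (ofCoords a b c d) = a ^ 2 + b ^ 2 + c ^ 2 + d ^ 2 :=
  Quaternion.normSq_def' _

section Reduction

variable {p : ℕ} {s t : ZMod p}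

/-- The quaternion basis of `2 × 2` matrices modulo `p` attached to a solution of
`s ^ 2 + t ^ 2 = -1`. -/
def matrixBasis (h : s ^ 2 + t ^ 2 = -1) :
    QuaternionAlgebra.Basis (Matrix (Fin 2) (Fin 2) (ZMod p)) (-1 : ℤ) 0 (-1) where
  i := !![0, -1; 1, 0]
  j := !![s, t; t, -s]
  k := !![-t, s; s, t]
  i_mul_i := by ext i j; fin_cases i <;> fin_cases j <;> simp
  j_mul_j := by ext i j; fin_cases i <;> fin_cases j <;> simp <;> grind
  i_mul_j := by ext i j; fin_cases i <;> fin_cases j <;> simp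
  j_mul_i := by ext i j; fin_cases i <;> fin_cases j <;> simp

/-- Reduction of Lipschitz quaternions modulo `p`, as `2 × 2` matrices. -/
def toMatrix (h : s ^ 2 + t ^ 2 = -1) :
    ℍ[ℤ] →ₐ[ℤ] Matrix (Fin 2) (Fin 2) (ZMod p) :=
  (matrixBasis h).liftHom

variable (h : s ^ 2 + t ^ 2 = -1)

theorem toMatrix_apply (α : ℍ[ℤ]) : toMatrix h α =
    !![α.re + s * α.imJ - t * α.imK, -α.imI + t * α.imJ + s * α.imK;
      α.imI + t * α.imJ + s * α.imK, α.re - s * α.imJ + t * α.imK] := by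
  have hlift : toMatrix h α = (matrixBasis h).lift α := rfl
  rw [hlift]
  unfold QuaternionAlgebra.Basis.lift
  rw [Algebra.algebraMap_eq_smul_one, one_fin_two]
  ext i j
  fin_cases i <;> fin_cases j <;> simp [matrixBasis, -zsmul_eq_mul] <;> ring

theorem det_toMatrix (α : ℍ[ℤ]) :
    (toMatrix h α).det = ((Quaternion.normSq α : ℤ) : ZMod p) := by
  rw [toMatrix_apply, det_fin_two_of, Quaternion.normSq_def']
  push_cast
  linear_combination (-(α.imJ : ZMod p) ^ 2 - (α.imK : ZMod p) ^ 2) * h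

theorem toMatrix_star (α : ℍ[ℤ]) : toMatrix h (star α) = (toMatrix h α).adjugate := by
  rw [toMatrix_apply, toMatrix_apply, adjugate_fin_two_of]
  ext i j
  fin_cases i <;> fin_cases j <;> simp <;> ring

theorem exists_eq_smul_of_toMatrix_eq_zero [Fact p.Prime] (hp2 : p ≠ 2) {α : ℍ[ℤ]}
    (hα : toMatrix h α = 0) : ∃ β : ℍ[ℤ], α = (p : ℤ) • β := by
  have h2 : (2 : ZMod p) ≠ 0 := Ring.two_ne_zero (by rwa [ZMod.ringChar_zmod_n])
  rw [toMatrix_apply] at hα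
  have h00 := congrFun (congrFun hα 0) 0
  have h01 := congrFun (congrFun hα 0) 1
  have h10 := congrFun (congrFun hα 1) 0
  have h11 := congrFun (congrFun hα 1) 1
  simp at h00 h01 h10 h11
  have ha : (α.re : ZMod p) = 0 :=
    (mul_eq_zero.1 (by linear_combination h00 + h11 : (2 : ZMod p) * α.re = 0)).resolve_left h2
  have hb : (α.imI : ZMod p) = 0 :=
    (mul_eq_zero.1 (by linear_combination h10 - h01 : (2 : ZMod p) * α.imI = 0)).resolve_left h2
  have hc : (α.imJ : ZMod p) = 0 := by
    linear_combination (-s) * h00 - t * h01 + (α.imJ : ZMod p) * h + s * ha - t * hb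
  have hd : (α.imK : ZMod p) = 0 := by
    linear_combination t * h00 - s * h01 + (α.imK : ZMod p) * h - t * ha - s * hb
  rw [ZMod.intCast_zmod_eq_zero_iff_dvd] at ha hb hc hd
  obtain ⟨a, ha⟩ := ha
  obtain ⟨b, hb⟩ := hb
  obtain ⟨c, hc⟩ := hc
  obtain ⟨d, hd⟩ := hd
  exact ⟨ofCoords a b c d, by ext <;> simp [ha, hb, hc, hd]⟩

end Reduction

section Descent

theorem _root_.Int.exists_eq_add_mul_four_mul_sq_lt {n : ℤ} (hn : Odd n) (hpos : 0 < n) (a : ℤ) :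
    ∃ b q, a = b + n * q ∧ 4 * b ^ 2 < n ^ 2 := by
  have h1 := Int.emod_add_mul_ediv a n
  have h2 := Int.emod_nonneg a hpos.ne'
  have h3 := Int.emod_lt_of_pos a hpos
  obtain ⟨k, hk⟩ := hn
  by_cases h : 2 * (a % n) < n
  · exact ⟨a % n, a / n, h1.symm, by nlinarith⟩
  · exact ⟨a % n - n, a / n + 1, by linear_combination -h1, by
      nlinarith [show n < 2 * (a % n) by omega]⟩

/-- Division with small remainder by an odd positive integer. -/
theorem exists_eq_add_smul_normSq_lt {n : ℤ} (hn : Odd n) (hpos : 0 < n) (α : ℍ[ℤ]) :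
    ∃ β δ : ℍ[ℤ], α = β + n • δ ∧ Quaternion.normSq β < n ^ 2 := by
  obtain ⟨a, a', ha, ha2⟩ := Int.exists_eq_add_mul_four_mul_sq_lt hn hpos α.re
  obtain ⟨b, b', hb, hb2⟩ := Int.exists_eq_add_mul_four_mul_sq_lt hn hpos α.imI
  obtain ⟨c, c', hc, hc2⟩ := Int.exists_eq_add_mul_four_mul_sq_lt hn hpos α.imJ
  obtain ⟨d, d', hd, hd2⟩ := Int.exists_eq_add_mul_four_mul_sq_lt hn hpos α.imK
  refine ⟨ofCoords a b c d, ofCoords a' b' c' d', ?_, ?_⟩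
  · ext <;> simp [ha, hb, hc, hd]
  · rw [normSq_ofCoords]
    linarith

theorem exists_mul_eq_two_smul {α : ℍ[ℤ]} (hα : Even (Quaternion.normSq α)) :
    ∃ π β : ℍ[ℤ], Quaternion.normSq π = 2 ∧ π * α = (2 : ℤ) • β := by
  rw [Quaternion.normSq_def'] at hα
  generalize ha : α.re = a at hα
  generalize hb : α.imI = b at hα
  generalize hc : α.imJ = c at hα
  generalize hd : α.imK = d at hα
  simp only [Int.even_add, Int.even_pow] at hα
  have key : (Even (a - b) ∧ Even (c - d)) ∨ (Even (a - c) ∧ Even (b - d)) ∨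
      (Even (a - d) ∧ Even (b - c)) := by
    simp only [Int.even_sub]
    grind
  rcases key with ⟨⟨m, hm⟩, ⟨n, hn⟩⟩ | ⟨⟨m, hm⟩, ⟨n, hn⟩⟩ | ⟨⟨m, hm⟩, ⟨n, hn⟩⟩
  · refine ⟨ofCoords 1 1 0 0, ofCoords m (m + b) n (n + d), by simp, ?_⟩
    ext <;> simp [ha, hb, hc, hd, -zsmul_eq_mul] <;> linarith
  · refine ⟨ofCoords 1 0 1 0, ofCoords m (n + d) (m + c) (-n), by simp, ?_⟩
    ext <;> simp [ha, hb, hc, hd, -zsmul_eq_mul] <;> linarith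
  · refine ⟨ofCoords 1 0 0 1, ofCoords m n (n + c) (m + d), by simp, ?_⟩
    ext <;> simp [ha, hb, hc, hd, -zsmul_eq_mul] <;> linarith

variable {p : ℕ} [Fact p.Prime] {s t : ZMod p} (h : s ^ 2 + t ^ 2 = -1)

theorem toMatrix_mulVec_eq_zero_of_smul {m : ℤ} (hm : (m : ZMod p) ≠ 0) {α β γ : ℍ[ℤ]}
    (hγ : γ * α = m • β) {v : Fin 2 → ZMod p} (hv : toMatrix h α *ᵥ v = 0) :
    toMatrix h β *ᵥ v = 0 := by
  have h1 : m • (toMatrix h β *ᵥ v) = 0 := by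
    rw [← smul_mulVec, ← map_smul, ← hγ, map_mul, ← mulVec_mulVec, hv, mulVec_zero]
  rw [← Int.cast_smul_eq_zsmul (ZMod p)] at h1
  exact (smul_eq_zero.1 h1).resolve_left hm

/-- Euler's descent inside a left ideal: from norm `m * p` down to norm `p`. -/
theorem exists_normSq_eq_of_normSq_eq_mul (m : ℕ) (hm0 : 0 < m) (hmp : m < p)
    {v : Fin 2 → ZMod p} {α : ℍ[ℤ]} (hα : Quaternion.normSq α = m * p)
    (hv : toMatrix h α *ᵥ v = 0) :
    ∃ β : ℍ[ℤ], Quaternion.normSq β = p ∧ toMatrix h β *ᵥ v = 0 := by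
  have hp : p.Prime := Fact.out
  induction m using Nat.strong_induction_on generalizing α with
  | _ m ih =>
    have hmne : ((m : ℤ) : ZMod p) ≠ 0 := by
      rw [Int.cast_natCast, Ne, ZMod.natCast_eq_zero_iff]
      exact fun hd => absurd (Nat.le_of_dvd hm0 hd) (by omega)
    rcases Nat.even_or_odd m with ⟨k, hk⟩ | hodd
    · obtain ⟨π, β, hπ, hβ⟩ := exists_mul_eq_two_smul (α := α)
        (by rw [hα, hk]; exact ⟨k * p, by push_cast; ring⟩)
      refine ih k (by omega) (by omega) (by omega) (α := β) ?_
        (toMatrix_mulVec_eq_zero_of_smul h ?_ hβ hv)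
      · have h1 := congrArg Quaternion.normSq hβ
        rw [map_mul, Quaternion.normSq_smul, hπ, hα, hk] at h1
        push_cast at h1
        linarith
      · intro h2
        apply hmne
        rw [hk]
        push_cast at h2 ⊢
        linear_combination (k : ZMod p) * h2
    · rcases eq_or_ne m 1 with rfl | hm1
      · exact ⟨α, by simpa using hα, hv⟩
      obtain ⟨β, δ, hβ, hlt⟩ := exists_eq_add_smul_normSq_lt (n := (m : ℤ))
        (by exact_mod_cast hodd) (by exact_mod_cast hm0) α
      have hdvd : (m : ℤ) ∣ Quaternion.normSq β := by
        have h1 : β = α - (m : ℤ) • δ := by rw [hβ]; abel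
        have h2 : Quaternion.normSq β = m * (p - 2 * (α * star δ).re
            + m * Quaternion.normSq δ) := by
          rw [h1, sub_eq_add_neg, Quaternion.normSq_add, Quaternion.normSq_neg,
            Quaternion.normSq_smul, hα]
          simp
          ring
        exact ⟨_, h2⟩
      obtain ⟨r, hr⟩ := hdvd
      have hm0' : (0 : ℤ) < m := by exact_mod_cast hm0
      have hr0 : 0 ≤ r := by
        have := Quaternion.normSq_nonneg (a := β)
        rw [hr] at this
        exact nonneg_of_mul_nonneg_right this hm0'
      have hrm : r < m := by
        rw [hr, sq] at hlt
        exact lt_of_mul_lt_mul_left hlt hm0'.le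
      obtain ⟨r, rfl⟩ := Int.eq_ofNat_of_zero_le hr0
      have hγ : star β * α = (m : ℤ) • ((r : ℤ) • 1 + star β * δ) := by
        rw [hβ, mul_add, Quaternion.star_mul_self, hr, mul_smul_comm, smul_add]
        congr 1
        ext <;> simp
      have hrpos : 0 < r := by
        rcases Nat.eq_zero_or_pos r with rfl | hr'
        · exfalso
          have hβ0 : β = 0 := by
            rw [← Quaternion.normSq_eq_zero, hr]
            simp
          rw [hβ, hβ0, zero_add, Quaternion.normSq_smul, sq, mul_assoc] at hα
          have h1 := mul_left_cancel₀ hm0'.ne' hα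
          have h2 : m ∣ p := by
            rw [← Int.natCast_dvd_natCast, ← h1]
            exact dvd_mul_right _ _
          rcases (Nat.dvd_prime hp).1 h2 with h3 | h3 <;> omega
        · exact hr'
      refine ih r (by omega) hrpos (by omega) (α := (r : ℤ) • 1 + star β * δ) ?_
        (toMatrix_mulVec_eq_zero_of_smul h hmne hγ hv)
      have h1 := congrArg Quaternion.normSq hγ
      rw [map_mul, Quaternion.normSq_smul, Quaternion.normSq_star, hr, hα] at h1
      refine mul_left_cancel₀ (pow_ne_zero 2 hm0'.ne') (h1.symm.trans ?_)
      ring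

/-- The left ideal attached to a nonzero vector contains a quaternion of norm `p`. -/
theorem exists_normSq_eq_of_ne_zero (hodd : Odd p) {v : Fin 2 → ZMod p} (hv0 : v ≠ 0) :
    ∃ β : ℍ[ℤ], Quaternion.normSq β = p ∧ toMatrix h β *ᵥ v = 0 := by
  have hp : p.Prime := Fact.out
  have hp0 : (0 : ℤ) < p := by exact_mod_cast hp.pos
  have h2 : (2 : ZMod p) ≠ 0 := Ring.two_ne_zero <| by
    rw [ZMod.ringChar_zmod_n]
    rintro rfl
    exact absurd hodd (by decide)
  have hex : ∃ γ : ℍ[ℤ], toMatrix h γ = !![2 * v 1, -2 * v 0; 0, 0] := by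
    refine ⟨ofCoords (v 1).val (v 0).val (-(s * v 1 - t * v 0)).val (t * v 1 + s * v 0).val, ?_⟩
    rw [toMatrix_apply]
    ext i j
    fin_cases i <;> fin_cases j <;> simp <;> grind
  obtain ⟨γ, hγM⟩ := hex
  have hγ : toMatrix h γ *ᵥ v = 0 := by
    rw [hγM]
    funext i
    fin_cases i
    · simp [mulVec, dotProduct, Fin.sum_univ_two]
      ring
    · simp [mulVec, dotProduct, Fin.sum_univ_two]
  obtain ⟨β, δ, hβ, hlt⟩ := exists_eq_add_smul_normSq_lt (n := (p : ℤ))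
    (by exact_mod_cast hodd) hp0 γ
  have hφ : toMatrix h β = toMatrix h γ := by
    rw [hβ, map_add, map_smul, ← Int.cast_smul_eq_zsmul (ZMod p)]
    simp
  rw [← hφ] at hγ
  have hβ0 : β ≠ 0 := by
    rintro rfl
    rw [map_zero, hγM] at hφ
    have h00 := congrFun (congrFun hφ 0) 0
    have h01 := congrFun (congrFun hφ 0) 1
    apply hv0
    funext i
    fin_cases i
    · simpa [h2] using h01.symm
    · simpa [h2] using h00.symm
  have hdet : ((Quaternion.normSq β : ℤ) : ZMod p) = 0 := by
    rw [← det_toMatrix h]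
    exact exists_mulVec_eq_zero_iff.1 ⟨v, hv0, hγ⟩
  rw [ZMod.intCast_zmod_eq_zero_iff_dvd] at hdet
  obtain ⟨m, hm⟩ := hdet
  have hpos : 0 < Quaternion.normSq β :=
    lt_of_le_of_ne Quaternion.normSq_nonneg (Quaternion.normSq_ne_zero.2 hβ0).symm
  rw [hm] at hpos hlt
  have hm0 : 0 < m := pos_of_mul_pos_right hpos hp0.le
  have hmp : m < p := lt_of_mul_lt_mul_left (by rwa [sq] at hlt) hp0.le
  obtain ⟨m, rfl⟩ := Int.eq_ofNat_of_zero_le hm0.le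
  exact exists_normSq_eq_of_normSq_eq_mul h m (by exact_mod_cast hm0) (by exact_mod_cast hmp)
    (by rw [hm, mul_comm]) hγ

end Descent

section Count

/-- The real coordinate has a different parity from all three imaginary coordinates. -/
def IsDistinguished (α : ℍ[ℤ]) : Prop :=
  Odd (α.re + α.imI) ∧ Odd (α.re + α.imJ) ∧ Odd (α.re + α.imK)

theorem IsDistinguished.neg {α : ℍ[ℤ]} (hα : IsDistinguished α) : IsDistinguished (-α) := by
  obtain ⟨h1, h2, h3⟩ := hα
  refine ⟨?_, ?_, ?_⟩
  · simpa [neg_add, add_comm] using h1.neg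
  · simpa [neg_add, add_comm] using h2.neg
  · simpa [neg_add, add_comm] using h3.neg

/-- Every quaternion of odd norm has a distinguished left associate. -/
theorem exists_isDistinguished_mul {α : ℍ[ℤ]} (hα : Odd (Quaternion.normSq α)) :
    ∃ u : ℍ[ℤ], Quaternion.normSq u = 1 ∧ IsDistinguished (u * α) := by
  rw [Quaternion.normSq_def'] at hα
  have key : IsDistinguished (ofCoords 1 0 0 0 * α) ∨ IsDistinguished (ofCoords 0 1 0 0 * α) ∨
      IsDistinguished (ofCoords 0 0 1 0 * α) ∨ IsDistinguished (ofCoords 0 0 0 1 * α) := by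
    simp only [IsDistinguished, Quaternion.re_mul, Quaternion.imI_mul, Quaternion.imJ_mul,
      Quaternion.imK_mul, re_ofCoords, imI_ofCoords, imJ_ofCoords, imK_ofCoords]
    simp [parity_simps] at hα ⊢
    grind
  rcases key with h | h | h | h
  · exact ⟨_, by simp, h⟩
  · exact ⟨_, by simp, h⟩
  · exact ⟨_, by simp, h⟩
  · exact ⟨_, by simp, h⟩

theorem eq_one_or_eq_neg_one_of_isDistinguished_mul {u α : ℍ[ℤ]} (hu : Quaternion.normSq u = 1)
    (hα : IsDistinguished α) (huα : IsDistinguished (u * α)) : u = 1 ∨ u = -1 := by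
  rw [Quaternion.normSq_def'] at hu
  have h0 : u.imI = 0 ∧ u.imJ = 0 ∧ u.imK = 0 := by
    have hpar : Odd (u.re ^ 2 + u.imI ^ 2 + u.imJ ^ 2 + u.imK ^ 2) := by rw [hu]; exact odd_one
    have hre : u.re ≠ 0 := by
      intro h
      have h1 : u.imI * u.imJ = 0 := by
        nlinarith [sq_nonneg (u.imI + u.imJ), sq_nonneg (u.imI - u.imJ), sq_nonneg u.imK]
      have h2 : u.imI * u.imK = 0 := by
        nlinarith [sq_nonneg (u.imI + u.imK), sq_nonneg (u.imI - u.imK), sq_nonneg u.imJ]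
      have h3 : u.imJ * u.imK = 0 := by
        nlinarith [sq_nonneg (u.imJ + u.imK), sq_nonneg (u.imJ - u.imK), sq_nonneg u.imI]
      simp only [IsDistinguished, Quaternion.re_mul, Quaternion.imI_mul, Quaternion.imJ_mul,
        Quaternion.imK_mul] at hα huα
      simp only [mul_eq_zero] at h1 h2 h3
      rcases h1 with h1 | h1 <;> rcases h2 with h2 | h2 <;> rcases h3 with h3 | h3 <;>
        simp [h, h1, h2, h3, parity_simps] at hpar hu hα huα <;> grind
    have h1 : 1 ≤ u.re ^ 2 := by
      have := sq_pos_of_ne_zero hre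
      omega
    refine ⟨?_, ?_, ?_⟩ <;>
      refine pow_eq_zero_iff (two_ne_zero) |>.1 ?_ <;>
      nlinarith [sq_nonneg u.imI, sq_nonneg u.imJ, sq_nonneg u.imK]
  obtain ⟨h1, h2, h3⟩ := h0
  have hre : u.re ^ 2 = 1 := by simpa [h1, h2, h3] using hu
  rcases sq_eq_sq_iff_eq_or_eq_neg.1 (hre.trans (one_pow 2).symm) with h | h
  · left
    ext <;> simp [h, h1, h2, h3]
  · right
    ext <;> simp [h, h1, h2, h3]

variable {p : ℕ} [Fact p.Prime] {s t : ZMod p} (h : s ^ 2 + t ^ 2 = -1)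

/-- Two quaternions of norm `p` with a common kernel modulo `p` are left associates. -/
theorem exists_eq_mul_of_normSq_eq (hp2 : p ≠ 2) {v : Option (ZMod p)} {α β : ℍ[ℤ]}
    (hα : Quaternion.normSq α = p) (hβ : Quaternion.normSq β = p)
    (hvα : toMatrix h α *ᵥ projectivePoint v = 0) (hvβ : toMatrix h β *ᵥ projectivePoint v = 0) :
    ∃ u : ℍ[ℤ], Quaternion.normSq u = 1 ∧ β = u * α := by
  have hp0 : (p : ℤ) ≠ 0 := by exact_mod_cast (Fact.out : p.Prime).ne_zero
  have hzero : toMatrix h (β * star α) = 0 := by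
    rw [map_mul, toMatrix_star, mul_adjugate_eq_zero hvα hvβ]
  obtain ⟨u, hu⟩ := exists_eq_smul_of_toMatrix_eq_zero h hp2 hzero
  refine ⟨u, ?_, ?_⟩
  · have h1 := congrArg Quaternion.normSq hu
    rw [map_mul, Quaternion.normSq_star, Quaternion.normSq_smul, hα, hβ] at h1
    refine mul_left_cancel₀ (pow_ne_zero 2 hp0) (h1.symm.trans ?_)
    ring
  · have h1 := congrArg (· * α) hu
    simp only [mul_assoc, Quaternion.star_mul_self, hα, smul_mul_assoc] at h1
    rw [← Quaternion.coe_commutes, Quaternion.coe_mul_eq_smul] at h1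
    exact smul_right_injective _ hp0 h1

theorem exists_isDistinguished_pair (hodd : Odd p) (v : Option (ZMod p)) :
    ∃ α : ℍ[ℤ], α ≠ -α ∧ ∀ β : ℍ[ℤ],
      (Quaternion.normSq β = p ∧ IsDistinguished β ∧ toMatrix h β *ᵥ projectivePoint v = 0) ↔
        β = α ∨ β = -α := by
  have hp : p.Prime := Fact.out
  have hp2 : p ≠ 2 := by
    rintro rfl
    exact absurd hodd (by decide)
  obtain ⟨α, hα, hvα⟩ := exists_normSq_eq_of_ne_zero h hodd (projectivePoint_ne_zero v)
  obtain ⟨w, hw, hwα⟩ := exists_isDistinguished_mul (α := α)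
    (by rw [hα]; exact_mod_cast hodd)
  have hN : Quaternion.normSq (w * α) = p := by rw [map_mul, hw, hα, one_mul]
  have hK : toMatrix h (w * α) *ᵥ projectivePoint v = 0 := by
    rw [map_mul, ← mulVec_mulVec, hvα, mulVec_zero]
  refine ⟨w * α, fun hneg => ?_, fun β => ⟨?_, ?_⟩⟩
  · have h1 := congrArg Quaternion.normSq (add_eq_zero_iff_eq_neg.2 hneg)
    rw [← two_zsmul, Quaternion.normSq_smul, hN, map_zero] at h1
    have := hp.pos
    omega
  · rintro ⟨hβ, hdβ, hvβ⟩
    obtain ⟨u, hu, rfl⟩ := exists_eq_mul_of_normSq_eq h hp2 hN hβ hK hvβ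
    rcases eq_one_or_eq_neg_one_of_isDistinguished_mul hu hwα hdβ with rfl | rfl
    · exact Or.inl (one_mul _)
    · exact Or.inr (neg_one_mul _)
  · rintro (rfl | rfl)
    · exact ⟨hN, hwα, hK⟩
    · exact ⟨by rw [Quaternion.normSq_neg, hN], hwα.neg, by rw [map_neg, neg_mulVec, hK, neg_zero]⟩

theorem existsUnique_toMatrix_mulVec_eq_zero (hp2 : p ≠ 2) {α : ℍ[ℤ]}
    (hα : Quaternion.normSq α = p) :
    ∃! v : Option (ZMod p), toMatrix h α *ᵥ projectivePoint v = 0 := by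
  have hp : p.Prime := Fact.out
  refine existsUnique_mulVec_projectivePoint_eq_zero (fun h0 => ?_) ?_
  · obtain ⟨β, rfl⟩ := exists_eq_smul_of_toMatrix_eq_zero h hp2 h0
    rw [Quaternion.normSq_smul, sq, mul_assoc] at hα
    have hdvd : (p : ℤ) ∣ 1 := by
      refine ⟨Quaternion.normSq β, ?_⟩
      refine mul_left_cancel₀ (a := (p : ℤ)) (by exact_mod_cast hp.ne_zero) ?_
      rw [hα, mul_one]
    exact hp.one_lt.ne' (by exact_mod_cast Int.eq_one_of_dvd_one (by positivity) hdvd)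
  · rw [det_toMatrix, hα]
    simp

theorem finite_setOf_normSq_eq (n : ℤ) : {α : ℍ[ℤ] | Quaternion.normSq α = n}.Finite := by
  have hbox : (Set.Icc (-n) n ×ˢ Set.Icc (-n) n ×ˢ Set.Icc (-n) n ×ˢ Set.Icc (-n) n).Finite :=
    (Set.finite_Icc _ _).prod ((Set.finite_Icc _ _).prod
      ((Set.finite_Icc _ _).prod (Set.finite_Icc _ _)))
  refine (hbox.image fun x => ofCoords x.1 x.2.1 x.2.2.1 x.2.2.2).subset fun α hα => ?_
  rw [Set.mem_ofPred_eq, Quaternion.normSq_def'] at hα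
  have hle (z : ℤ) (hz : z ^ 2 ≤ n) : z ∈ Set.Icc (-n) n :=
    ⟨by nlinarith [Int.le_self_sq (-z)], by nlinarith [Int.le_self_sq z]⟩
  exact ⟨(α.re, α.imI, α.imJ, α.imK), ⟨hle _ (by nlinarith), hle _ (by nlinarith),
    hle _ (by nlinarith), hle _ (by nlinarith)⟩, rfl⟩

theorem ncard_isDistinguished_normSq_eq (hodd : Odd p) :
    {α : ℍ[ℤ] | Quaternion.normSq α = p ∧ IsDistinguished α}.ncard = 2 * (p + 1) := by
  classical
  have hp2 : p ≠ 2 := by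
    rintro rfl
    exact absurd hodd (by decide)
  obtain ⟨s, t, h⟩ := ZMod.sq_add_sq p (-1)
  have hfin : {α : ℍ[ℤ] | Quaternion.normSq α = p ∧ IsDistinguished α}.Finite :=
    (finite_setOf_normSq_eq p).subset fun α hα => hα.1
  rw [Set.ncard_eq_toFinset_card _ hfin]
  have hcount := Finset.card_mul_eq_card_mul (s := hfin.toFinset)
    (t := (Finset.univ : Finset (Option (ZMod p)))) (m := 1) (n := 2)
    (fun α v => toMatrix h α *ᵥ projectivePoint v = 0) ?_ ?_
  · rw [mul_one, Finset.card_univ, Fintype.card_option, ZMod.card] at hcount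
    rw [hcount, mul_comm]
  · intro α hα
    rw [Set.Finite.mem_toFinset] at hα
    obtain ⟨v, hv, huniq⟩ := existsUnique_toMatrix_mulVec_eq_zero h hp2 hα.1
    rw [Finset.card_eq_one]
    refine ⟨v, ?_⟩
    ext w
    simp only [Finset.mem_bipartiteAbove, Finset.mem_univ, true_and, Finset.mem_singleton]
    exact ⟨huniq w, fun hw => hw ▸ hv⟩
  · intro v _
    obtain ⟨α, hne, hα⟩ := exists_isDistinguished_pair h hodd v
    rw [Finset.card_eq_two]
    refine ⟨α, -α, hne, ?_⟩
    ext β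
    rw [Finset.mem_bipartiteBelow, Set.Finite.mem_toFinset, Set.mem_ofPred_eq, Finset.mem_insert,
      Finset.mem_singleton, ← hα β, and_assoc]

/-- Any description of the distinguished quaternions of norm `p` by coordinates has the expected
count. -/
theorem ncard_coords_eq (hodd : Odd p) {P : ℤ × ℤ × ℤ × ℤ → Prop}
    (hP : ∀ x, P x ↔ x.1 ^ 2 + x.2.1 ^ 2 + x.2.2.1 ^ 2 + x.2.2.2 ^ 2 = (p : ℤ) ∧
      IsDistinguished (ofCoords x.1 x.2.1 x.2.2.1 x.2.2.2)) :
    {x | P x}.ncard = 2 * (p + 1) := by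
  rw [← ncard_isDistinguished_normSq_eq hodd]
  refine Set.ncard_congr (fun x _ => ofCoords x.1 x.2.1 x.2.2.1 x.2.2.2) ?_ ?_ ?_
  · intro x hx
    simpa using (hP x).1 hx
  · rintro ⟨a, b, c, d⟩ ⟨a', b', c', d'⟩ _ _ hxy
    have h1 := congrArg QuaternionAlgebra.re hxy
    have h2 := congrArg QuaternionAlgebra.imI hxy
    have h3 := congrArg QuaternionAlgebra.imJ hxy
    have h4 := congrArg QuaternionAlgebra.imK hxy
    simp only [re_ofCoords, imI_ofCoords, imJ_ofCoords, imK_ofCoords] at h1 h2 h3 h4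
    rw [h1, h2, h3, h4]
  · rintro α ⟨hα, hdα⟩
    refine ⟨(α.re, α.imI, α.imJ, α.imK), (hP _).2 ⟨?_, hdα⟩, rfl⟩
    rw [← hα, Quaternion.normSq_def']

end Count

theorem isDistinguished_ofCoords_iff {a b c d : ℤ} :
    IsDistinguished (ofCoords a b c d) ↔
      (Odd a ∧ Even b ∧ Even c ∧ Even d) ∨ (Even a ∧ Odd b ∧ Odd c ∧ Odd d) := by
  simp only [IsDistinguished, re_ofCoords, imI_ofCoords, imJ_ofCoords, imK_ofCoords,
    ← Int.not_even_iff_odd, Int.even_add]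
  tauto

end LipschitzQuaternion

theorem Int.sq_emod_four_of_even {a : ℤ} (ha : Even a) : a ^ 2 % 4 = 0 := by
  obtain ⟨k, rfl⟩ := ha
  have : (k + k) ^ 2 = 4 * k ^ 2 := by ring
  omega


/-- Let `p` be an odd prime. If `p ≡ 1 (mod 4)`, the set of quadruples
`(a,b,c,d) ∈ ℤ⁴` with `a² + b² + c² + d² = p`, `a` odd and `b, c, d` even has exactly
`2(p+1)` elements; if `p ≡ 3 (mod 4)`, the set of those with `a² + b² + c² + d² = p`,
`a` even and `b, c, d` odd has exactly `2(p+1)` elements. -/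
theorem count_norm_p_quadruples (p : ℕ) (hp : p.Prime) (hodd : Odd p) :
    (p % 4 = 1 →
      {x : ℤ × ℤ × ℤ × ℤ | x.1 ^ 2 + x.2.1 ^ 2 + x.2.2.1 ^ 2 + x.2.2.2 ^ 2 = (p : ℤ) ∧
        Odd x.1 ∧ Even x.2.1 ∧ Even x.2.2.1 ∧ Even x.2.2.2}.ncard = 2 * (p + 1)) ∧
    (p % 4 = 3 →
      {x : ℤ × ℤ × ℤ × ℤ | x.1 ^ 2 + x.2.1 ^ 2 + x.2.2.1 ^ 2 + x.2.2.2 ^ 2 = (p : ℤ) ∧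
        Even x.1 ∧ Odd x.2.1 ∧ Odd x.2.2.1 ∧ Odd x.2.2.2}.ncard = 2 * (p + 1)) := by
  have : Fact p.Prime := ⟨hp⟩
  constructor
  · intro hmod
    refine LipschitzQuaternion.ncard_coords_eq hodd fun x => and_congr_right fun hx => ?_
    rw [LipschitzQuaternion.isDistinguished_ofCoords_iff]
    refine ⟨Or.inl, fun hx' => hx'.resolve_right ?_⟩
    rintro ⟨h1, h2, h3, h4⟩
    have h1 := Int.sq_emod_four_of_even h1
    have h2 := Int.sq_mod_four_eq_one_of_odd h2
    have h3 := Int.sq_mod_four_eq_one_of_odd h3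
    have h4 := Int.sq_mod_four_eq_one_of_odd h4
    omega
  · intro hmod
    refine LipschitzQuaternion.ncard_coords_eq hodd fun x => and_congr_right fun hx => ?_
    rw [LipschitzQuaternion.isDistinguished_ofCoords_iff]
    refine ⟨Or.inr, fun hx' => hx'.resolve_left ?_⟩
    rintro ⟨h1, h2, h3, h4⟩
    have h1 := Int.sq_mod_four_eq_one_of_odd h1
    have h2 := Int.sq_emod_four_of_even h2
    have h3 := Int.sq_emod_four_of_even h3
    have h4 := Int.sq_emod_four_of_even h4
    omega
end
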